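/- arXiv:math/0701788 — 2 statements merged into one kernel-verified Lean document; each statement's English description precedes it below -/
import Mathlib

section
/- Criterion for equality of α-sets: Let x, y ∈ X, let α > 1 be a countable ordinal, let c ⊆ ℕ be finite, and let σ, δ ∈ S^G_{<∞} with rng σ = rng δ = c. The following are equivalent: (i) B_α(x,σ) = B_α(y,δ); (ii) for every finite a ⊇ c and every ordinal ζ with 1 ≤ ζ < α, {B_ζ(x,σ') : σ' ∈ S^G_{<∞}, σ' ⊇ σ, rng σ' = a} = {B_ζ(y,δ') : δ' ∈ S^G_{<∞}, δ' ⊇ δ, rng δ' = a}; (iii) for every natural number n with c ⊆ {0,…,n−1} and every ordinal ζ with 1 ≤ ζ < α, {B_ζ(x,σ') : σ' ⊇ σ, rng σ' = {0,…,n−1}} = {B_ζ(y,δ') : δ' ⊇ δ, rng δ' = {0,…,n−1}}. -/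
open Set Pointwise

noncomputable section

/-- `S_∞`, the group of all permutations of `ℕ`. -/
abbrev Sinf : Type := Equiv.Perm ℕ

/-- The topology of pointwise convergence on `S_∞`. -/
instance SinfTopology : TopologicalSpace Sinf :=
  TopologicalSpace.induced (fun g : Sinf => (g : ℕ → ℕ)) Pi.topologicalSpace

/-- The graph of the restriction of a permutation `g` to a finite set `d`. -/
def restr (g : Sinf) (d : Finset ℕ) : Set (ℕ × ℕ) := {p | p.1 ∈ d ∧ g p.1 = p.2}

/-- The domain of a partial map coded by its graph. -/
def pdom (σ : Set (ℕ × ℕ)) : Set ℕ := Prod.fst '' σ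

/-- The range of a partial map coded by its graph. -/
def prng (σ : Set (ℕ × ℕ)) : Set ℕ := Prod.snd '' σ

/-- `S^G_{<∞}`: graphs of restrictions of elements of `G` to finite subsets of `ℕ`. -/
def SGfin (G : Subgroup Sinf) : Set (Set (ℕ × ℕ)) :=
  {σ | ∃ g ∈ G, ∃ d : Finset ℕ, σ = restr g d}

/-- `V^G_σ`: the elements of `G` extending the partial bijection `σ`. -/
def Vb (G : Subgroup Sinf) (σ : Set (ℕ × ℕ)) : Set G :=
  {g : G | ∀ p ∈ σ, (g : Sinf) p.1 = p.2}

/-- `V^G_c`: the pointwise stabilizer of `c ⊆ ℕ` in `G`. -/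
def Vc (G : Subgroup Sinf) (c : Set ℕ) : Set G :=
  {g : G | ∀ k ∈ c, (g : Sinf) k = k}

/-- The identity partial bijection on `c`. -/
def idb (c : Set ℕ) : Set (ℕ × ℕ) := {p | p.1 ∈ c ∧ p.2 = p.1}

/-- The composition `σ ∘ f`, restricted to `f⁻¹[dom σ]`. -/
def compR (σ : Set (ℕ × ℕ)) (f : Sinf) : Set (ℕ × ℕ) := {p | (f p.1, p.2) ∈ σ}

/-- The composition `f ∘ σ`. -/
def compL (f : Sinf) (σ : Set (ℕ × ℕ)) : Set (ℕ × ℕ) := {p | (p.1, f⁻¹ p.2) ∈ σ}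

/-- The Borel classes `Σ⁰_α(X)`: `Σ⁰_1(X)` consists of the open sets, and for `α > 1`,
`Σ⁰_α(X)` consists of countable unions of sets whose complements lie in
`⋃_{1 ≤ β < α} Σ⁰_β(X)` (i.e. of sets from `⋃_{1 ≤ β < α} Π⁰_β(X)`). -/
def SigmaB (X : Type*) [TopologicalSpace X] (α : Ordinal.{0}) : Set (Set X) :=
  if α ≤ 1 then {s | IsOpen s}
  else {s | ∃ f : ℕ → Set X,
      (∀ n, ∃ β : {γ : Ordinal.{0} // γ < α}, 1 ≤ β.1 ∧ (f n)ᶜ ∈ SigmaB X β.1) ∧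
      s = ⋃ n, f n}
termination_by α
decreasing_by exact β.2

/-- The Borel classes `Π⁰_α(X)`: complements of sets in `Σ⁰_α(X)`. -/
def PiB (X : Type*) [TopologicalSpace X] (α : Ordinal.{0}) : Set (Set X) :=
  {s | sᶜ ∈ SigmaB X α}

section Action

variable (G : Subgroup Sinf) {X : Type*} [TopologicalSpace X] [MulAction G X]

/-- The image `S • x` of a point under a set of group elements. -/
def setOrb (S : Set G) (x : X) : Set X := (fun g : G => g • x) '' S

/-- The image `S • B` of a set under a set of group elements. -/
def setSmul (S : Set G) (B : Set X) : Set X := ⋃ g ∈ S, g • B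

/-- The `1`-sets `B₁(x, σ)`. -/
def BsetOne (A : ℕ → Set X) (σ : Set (ℕ × ℕ)) (x : X) : Set X :=
  (⋂ l, ⋂ (_ : (setOrb G (Vb G σ) x ∩ A l).Nonempty), setSmul G (Vc G (prng σ)) (A l)) ∩
    (⋂ l, ⋂ (_ : setOrb G (Vb G σ) x ∩ A l = ∅), (setSmul G (Vc G (prng σ)) (A l))ᶜ)

/-- The successor step of the recursion defining the `α`-sets. -/
def BsetSucc (prev : Set (ℕ × ℕ) → X → Set X) (σ : Set (ℕ × ℕ)) (x : X) : Set X :=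
  (⋂ b : Finset ℕ, ⋂ (_ : pdom σ ⊆ ↑b),
      ⋃ σ' ∈ SGfin G, ⋃ (_ : σ ⊆ σ') (_ : pdom σ' = ↑b), prev σ' x) ∩
    (⋂ a : Finset ℕ, ⋂ (_ : prng σ ⊆ ↑a),
      ⋃ σ' ∈ SGfin G, ⋃ (_ : σ ⊆ σ') (_ : prng σ' = ↑a), prev σ' x)

/-- The `α`-sets `B_α(x, σ)`, for `α ≥ 1` (the value at `α = 0` is junk). -/
def Bset (A : ℕ → Set X) (α : Ordinal.{0}) : Set (ℕ × ℕ) → X → Set X :=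
  @Ordinal.limitRecOn (fun _ => Set (ℕ × ℕ) → X → Set X) α
    (fun _ _ => univ)
    (fun o ih => if o = 0 then BsetOne G A else BsetSucc G ih)
    (fun o _ ih σ x => ⋂ β : Ordinal.{0}, ⋂ (hβ : β < o), ⋂ (_ : 1 ≤ β), ih β hβ σ x)

/-- The family `𝓑^x_{<α}` consisting of the basic open sets together with all
`β`-sets of `x` for `1 ≤ β < α`. -/
def BltFam (A : ℕ → Set X) (x : X) (α : Ordinal.{0}) : Set (Set X) :=
  {B | (∃ l, B = A l) ∨
    ∃ β : Ordinal.{0}, 1 ≤ β ∧ β < α ∧ ∃ σ ∈ SGfin G, B = Bset G A β σ x}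

/-- `γ^G_*(x)`: the least countable ordinal `γ` such that for all `σ, δ ∈ S^G_{<∞}`
with equal ranges, if `B_α(x,σ) ≠ B_α(x,δ)` for some countable ordinal `α ≥ 1`,
then already `B_γ(x,σ) ≠ B_γ(x,δ)`. -/
def gammaStar (A : ℕ → Set X) (x : X) : Ordinal :=
  sInf {γ : Ordinal.{0} | γ.card ≤ Cardinal.aleph0 ∧
    ∀ σ ∈ SGfin G, ∀ δ ∈ SGfin G, prng σ = prng δ →
      (∃ α : Ordinal.{0}, 1 ≤ α ∧ α.card ≤ Cardinal.aleph0 ∧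
        Bset G A α σ x ≠ Bset G A α δ x) →
      Bset G A γ σ x ≠ Bset G A γ δ x}

end Action

/-- The topology on a subset `S ⊆ X` generated by the traces on `S` of the members
of the family `F`. -/
def traceTop {X : Type*} (S : Set X) (F : Set (Set X)) : TopologicalSpace S :=
  TopologicalSpace.generateFrom {u : Set S | ∃ B ∈ F, u = Subtype.val ⁻¹' B}

/-- The space of closed subsets of `Y`. -/
def EffrosSpace (Y : Type*) [TopologicalSpace Y] := {K : Set Y // IsClosed K}

/-- The Effros Borel structure on the space of closed subsets of `Y`. -/
def effrosSigma (Y : Type*) [TopologicalSpace Y] : MeasurableSpace (EffrosSpace Y) :=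
  MeasurableSpace.generateFrom
    {S | ∃ U : Set Y, IsOpen U ∧ S = {K : EffrosSpace Y | (K.1 ∩ U).Nonempty}}

section Aux

variable {G : Subgroup Sinf} {X : Type*} [TopologicalSpace X] [MulAction G X]

theorem perm_inv_apply (f : Sinf) (k : ℕ) : f⁻¹ (f k) = k := f.symm_apply_apply k

theorem perm_apply_inv (f : Sinf) (k : ℕ) : f (f⁻¹ k) = k := f.apply_symm_apply k

theorem Vc_one (c : Set ℕ) : (1 : G) ∈ Vc G c := fun _ _ => rfl

theorem Vc_mul {c : Set ℕ} {g h : G} (hg : g ∈ Vc G c) (hh : h ∈ Vc G c) : g * h ∈ Vc G c := by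
  intro k hk
  show (g : Sinf) ((h : Sinf) k) = k
  rw [hh k hk, hg k hk]

theorem Vc_inv {c : Set ℕ} {g : G} (hg : g ∈ Vc G c) : g⁻¹ ∈ Vc G c := by
  intro k hk
  show ((g : Sinf)⁻¹) k = k
  rw [Equiv.Perm.inv_eq_iff_eq]
  exact (hg k hk).symm

theorem Vc_mono {c c' : Set ℕ} (h : c ⊆ c') {g : G} (hg : g ∈ Vc G c') : g ∈ Vc G c :=
  fun k hk => hg k (h hk)

theorem Vc_image {c : Finset ℕ} {g : G} (hg : g ∈ Vc G (c : Set ℕ)) :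
    c.image (g : Sinf) = c := by
  ext k
  simp only [Finset.mem_image]
  constructor
  · rintro ⟨a, ha, rfl⟩
    rw [hg a ha]; exact ha
  · intro hk
    exact ⟨k, hk, hg k hk⟩

theorem Vc_conj {c : Finset ℕ} {g f : G} (hg : g ∈ Vc G (c : Set ℕ)) :
    f * g * f⁻¹ ∈ Vc G ((c.image (f : Sinf) : Finset ℕ) : Set ℕ) := by
  intro k hk
  simp only [Finset.coe_image, Set.mem_image] at hk
  obtain ⟨a, ha, rfl⟩ := hk
  show (f : Sinf) ((g : Sinf) ((f : Sinf)⁻¹ ((f : Sinf) a))) = (f : Sinf) a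
  rw [perm_inv_apply, hg a ha]

theorem image_inv_image (f : G) (a : Finset ℕ) :
    (a.image ((f⁻¹ : G) : Sinf)).image (f : Sinf) = a := by
  rw [Finset.image_image]
  have : ((f : Sinf) : ℕ → ℕ) ∘ (((f⁻¹ : G) : Sinf) : ℕ → ℕ) = id := by
    ext k
    exact perm_apply_inv (f : Sinf) k
  rw [this, Finset.image_id]

theorem image_image_inv (f : G) (a : Finset ℕ) :
    (a.image (f : Sinf)).image ((f⁻¹ : G) : Sinf) = a := by
  simpa using image_inv_image f⁻¹ a

theorem image_mul (f g : G) (a : Finset ℕ) :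
    a.image ((f * g : G) : Sinf) = (a.image (g : Sinf)).image (f : Sinf) := by
  rw [Finset.image_image]
  rfl

/-- Base equivalence: equal orbit closures. -/
def baseR (G : Subgroup Sinf) {X : Type*} [TopologicalSpace X] [MulAction G X]
    (c : Finset ℕ) (x z : X) : Prop :=
  ∀ U : Set X, IsOpen U →
    ((∃ g ∈ Vc G (c : Set ℕ), g • x ∈ U) ↔ (∃ g ∈ Vc G (c : Set ℕ), g • z ∈ U))

/-- Back-and-forth equivalence. -/
def RR (G : Subgroup Sinf) {X : Type*} [TopologicalSpace X] [MulAction G X]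
    (α : Ordinal.{0}) (c : Finset ℕ) (x z : X) : Prop :=
  baseR G c x z ∧ ∀ β : {γ : Ordinal.{0} // γ < α}, 1 ≤ β.1 → ∀ a : Finset ℕ, c ⊆ a →
    (∃ g ∈ Vc G (c : Set ℕ), RR G β.1 a x (g • z)) ∧
    (∃ g ∈ Vc G (c : Set ℕ), RR G β.1 a (g • x) z)
termination_by α
decreasing_by all_goals exact β.2

theorem RR_iff {α : Ordinal.{0}} {c : Finset ℕ} {x z : X} :
    RR G α c x z ↔ baseR G c x z ∧ ∀ β < α, 1 ≤ β → ∀ a : Finset ℕ, c ⊆ a →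
      (∃ g ∈ Vc G (c : Set ℕ), RR G β a x (g • z)) ∧
      (∃ g ∈ Vc G (c : Set ℕ), RR G β a (g • x) z) := by
  rw [RR]
  simp only [Subtype.forall]

theorem baseR_symm {c : Finset ℕ} {x z : X} (h : baseR G c x z) : baseR G c z x :=
  fun U hU => (h U hU).symm

theorem baseR_trans {c : Finset ℕ} {x y z : X} (h : baseR G c x y) (h' : baseR G c y z) :
    baseR G c x z :=
  fun U hU => (h U hU).trans (h' U hU)

theorem baseR_smul {c : Finset ℕ} {x : X} {k : G} (hk : k ∈ Vc G (c : Set ℕ)) :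
    baseR G c x (k • x) := by
  intro U _
  constructor
  · rintro ⟨g, hg, h⟩
    exact ⟨g * k⁻¹, Vc_mul hg (Vc_inv hk), by simpa [smul_smul] using h⟩
  · rintro ⟨g, hg, h⟩
    exact ⟨g * k, Vc_mul hg hk, by simpa [smul_smul] using h⟩

theorem baseR_restrict [ContinuousConstSMul G X] {c c' : Finset ℕ} (hc : c ⊆ c') {x z : X}
    (h : baseR G c' x z) : baseR G c x z := by
  have key : ∀ x z : X, baseR G c' x z → ∀ U : Set X, IsOpen U →
      (∃ g ∈ Vc G (c : Set ℕ), g • x ∈ U) → (∃ g ∈ Vc G (c : Set ℕ), g • z ∈ U) := by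
    rintro x z h U hU ⟨g, hg, hx⟩
    obtain ⟨k, hk, hz⟩ := (h ((fun w => g • w) ⁻¹' U) (hU.preimage (continuous_const_smul g))).1
      ⟨1, Vc_one _, by simpa using hx⟩
    exact ⟨g * k, Vc_mul hg (Vc_mono (by exact_mod_cast hc) hk), by simpa [smul_smul] using hz⟩
  exact fun U hU => ⟨key x z h U hU, key z x (baseR_symm h) U hU⟩

theorem baseR_equiv [ContinuousConstSMul G X] {c : Finset ℕ} {x z : X} (f : G)
    (h : baseR G c x z) : baseR G (c.image (f : Sinf)) (f • x) (f • z) := by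
  have key : ∀ x z : X, baseR G c x z → ∀ U : Set X, IsOpen U →
      (∃ g ∈ Vc G ((c.image (f : Sinf) : Finset ℕ) : Set ℕ), g • f • x ∈ U) →
      (∃ g ∈ Vc G ((c.image (f : Sinf) : Finset ℕ) : Set ℕ), g • f • z ∈ U) := by
    rintro x z h U hU ⟨g, hg, hx⟩
    have hg' := Vc_conj (f := f⁻¹) hg
    rw [image_image_inv] at hg'
    obtain ⟨k, hk, hz⟩ := (h ((fun w => f • w) ⁻¹' U) (hU.preimage (continuous_const_smul f))).1
      ⟨_, hg', by simpa [smul_smul, mul_assoc] using hx⟩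
    exact ⟨_, Vc_conj (f := f) hk, by simpa [smul_smul, mul_assoc] using hz⟩
  exact fun U hU => ⟨key x z h U hU, key z x (baseR_symm h) U hU⟩

theorem RR_mono {α β : Ordinal.{0}} (hβ : β ≤ α) {c : Finset ℕ} {x z : X}
    (h : RR G α c x z) : RR G β c x z := by
  rw [RR_iff] at h ⊢
  exact ⟨h.1, fun γ hγ => h.2 γ (hγ.trans_le hβ)⟩

theorem RR_refl (α : Ordinal.{0}) : ∀ (c : Finset ℕ) (x : X), RR G α c x x := by
  induction α using WellFoundedLT.induction with
  | ind α ih =>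
    intro c x
    rw [RR_iff]
    refine ⟨fun _ _ => Iff.rfl, fun β hβ _ a _ => ⟨⟨1, Vc_one _, ?_⟩, ⟨1, Vc_one _, ?_⟩⟩⟩ <;>
    · rw [one_smul]; exact ih β hβ a x

theorem RR_symm {α : Ordinal.{0}} : ∀ {c : Finset ℕ} {x z : X}, RR G α c x z → RR G α c z x := by
  induction α using WellFoundedLT.induction with
  | ind α ih =>
    intro c x z h
    rw [RR_iff] at h ⊢
    refine ⟨baseR_symm h.1, fun β hβ h1 a ha => ?_⟩
    obtain ⟨⟨g, hg, h2⟩, ⟨k, hk, h3⟩⟩ := h.2 β hβ h1 a ha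
    exact ⟨⟨k, hk, ih β hβ h3⟩, ⟨g, hg, ih β hβ h2⟩⟩

theorem RR_equiv [ContinuousConstSMul G X] {α : Ordinal.{0}} : ∀ {c : Finset ℕ} {x z : X} (f : G),
    RR G α c x z → RR G α (c.image (f : Sinf)) (f • x) (f • z) := by
  induction α using WellFoundedLT.induction with
  | ind α ih =>
    intro c x z f h
    rw [RR_iff] at h ⊢
    refine ⟨baseR_equiv f h.1, fun β hβ h1 a ha => ?_⟩
    have hca : c ⊆ a.image ((f⁻¹ : G) : Sinf) := by
      have := Finset.image_subset_image (f := ((f⁻¹ : G) : Sinf)) ha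
      rwa [image_image_inv] at this
    obtain ⟨⟨g, hg, h2⟩, ⟨k, hk, h3⟩⟩ := h.2 β hβ h1 _ hca
    have h2' := ih β hβ f h2
    have h3' := ih β hβ f h3
    rw [image_inv_image] at h2' h3'
    refine ⟨⟨_, Vc_conj (f := f) hg, ?_⟩, ⟨_, Vc_conj (f := f) hk, ?_⟩⟩
    · simpa [smul_smul, mul_assoc] using h2'
    · simpa [smul_smul, mul_assoc] using h3'

theorem RR_equiv_fix [ContinuousConstSMul G X] {α : Ordinal.{0}} {c : Finset ℕ} {x z : X} {f : G}
    (hf : f ∈ Vc G (c : Set ℕ)) (h : RR G α c x z) : RR G α c (f • x) (f • z) := by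
  have := RR_equiv f h
  rwa [Vc_image hf] at this

theorem RR_trans [ContinuousConstSMul G X] {α : Ordinal.{0}} : ∀ {c : Finset ℕ} {x y z : X},
    RR G α c x y → RR G α c y z → RR G α c x z := by
  induction α using WellFoundedLT.induction with
  | ind α ih =>
    intro c x y z h h'
    have key : ∀ x y z : X, RR G α c x y → RR G α c y z → ∀ β < α, 1 ≤ β → ∀ a : Finset ℕ, c ⊆ a →
        (∃ g ∈ Vc G (c : Set ℕ), RR G β a x (g • z)) := by
      intro x y z h h' β hβ h1 a ha
      obtain ⟨g, hg, h2⟩ := ((RR_iff.1 h).2 β hβ h1 a ha).1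
      obtain ⟨k, hk, h3⟩ := ((RR_iff.1 (RR_equiv_fix hg h')).2 β hβ h1 a ha).1
      exact ⟨k * g, Vc_mul hk hg, by rw [mul_smul]; exact ih β hβ h2 h3⟩
    rw [RR_iff]
    refine ⟨baseR_trans (RR_iff.1 h).1 (RR_iff.1 h').1, fun β hβ h1 a ha =>
      ⟨key x y z h h' β hβ h1 a ha, ?_⟩⟩
    obtain ⟨g, hg, h2⟩ := key z y x (RR_symm h') (RR_symm h) β hβ h1 a ha
    exact ⟨g, hg, RR_symm h2⟩

theorem RR_restrict [ContinuousConstSMul G X] {α : Ordinal.{0}} : ∀ {c c' : Finset ℕ} {x z : X},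
    c ⊆ c' → RR G α c' x z → RR G α c x z := by
  induction α using WellFoundedLT.induction with
  | ind α ih =>
    intro c c' x z hc h
    rw [RR_iff] at h ⊢
    refine ⟨baseR_restrict hc h.1, fun β hβ h1 a ha => ?_⟩
    obtain ⟨⟨g, hg, h2⟩, ⟨k, hk, h3⟩⟩ := h.2 β hβ h1 (a ∪ c') Finset.subset_union_right
    have hc' : (c : Set ℕ) ⊆ c' := by exact_mod_cast hc
    exact ⟨⟨g, Vc_mono hc' hg, ih β hβ Finset.subset_union_left h2⟩,
      ⟨k, Vc_mono hc' hk, ih β hβ Finset.subset_union_left h3⟩⟩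

theorem RR_succ_iff [ContinuousConstSMul G X] {α : Ordinal.{0}} (hα : 1 ≤ α) {c : Finset ℕ}
    {x z : X} :
    RR G (Order.succ α) c x z ↔ ∀ a : Finset ℕ, c ⊆ a →
      (∃ g ∈ Vc G (c : Set ℕ), RR G α a x (g • z)) ∧
      (∃ g ∈ Vc G (c : Set ℕ), RR G α a (g • x) z) := by
  constructor
  · intro h a ha
    exact (RR_iff.1 h).2 α (Order.lt_succ α) hα a ha
  · intro h
    rw [RR_iff]
    constructor
    · obtain ⟨⟨g, hg, h2⟩, -⟩ := h c subset_rfl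
      exact baseR_trans (RR_iff.1 h2).1 (baseR_symm (baseR_smul hg))
    · intro β hβ h1 a ha
      obtain ⟨⟨g, hg, h2⟩, ⟨k, hk, h3⟩⟩ := h a ha
      have := Order.lt_succ_iff.1 hβ
      exact ⟨⟨g, hg, RR_mono this h2⟩, ⟨k, hk, RR_mono this h3⟩⟩

theorem RR_limit_iff {α : Ordinal.{0}} (hα : Order.IsSuccLimit α) {c : Finset ℕ} {x z : X} :
    RR G α c x z ↔ ∀ β < α, 1 ≤ β → RR G β c x z := by
  constructor
  · intro h β hβ _
    exact RR_mono hβ.le h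
  · intro h
    have h1 : (1 : Ordinal.{0}) < α := by
      have h0 : (0 : Ordinal.{0}) < α := hα.bot_lt
      have := hα.succ_lt h0
      simpa using this
    rw [RR_iff]
    refine ⟨(RR_iff.1 (h 1 h1 le_rfl)).1, fun β hβ hb => ?_⟩
    exact (RR_iff.1 (h _ (hα.succ_lt hβ) (hb.trans (Order.le_succ β)))).2 β (Order.lt_succ β) hb

theorem pdom_restr (g : Sinf) (d : Finset ℕ) : pdom (restr g d) = d := by
  ext k
  simp [pdom, restr]

theorem prng_restr (g : Sinf) (d : Finset ℕ) :
    prng (restr g d) = ((d.image g : Finset ℕ) : Set ℕ) := by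
  ext k
  simp only [prng, restr, Set.mem_image, Set.mem_setOf_eq, Finset.coe_image, Finset.mem_coe]
  constructor
  · rintro ⟨p, ⟨h1, h2⟩, rfl⟩
    exact ⟨p.1, h1, h2⟩
  · rintro ⟨a, h1, rfl⟩
    exact ⟨(a, g a), ⟨h1, rfl⟩, rfl⟩

theorem ext_iff (g : G) (d : Finset ℕ) (τ : Set (ℕ × ℕ)) :
    (τ ∈ SGfin G ∧ restr (g : Sinf) d ⊆ τ) ↔
      ∃ k ∈ Vc G ((d.image (g : Sinf) : Finset ℕ) : Set ℕ), ∃ e : Finset ℕ, d ⊆ e ∧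
        τ = restr ((k * g : G) : Sinf) e := by
  constructor
  · rintro ⟨⟨f, hf, e, rfl⟩, hsub⟩
    refine ⟨⟨f, hf⟩ * g⁻¹, ?_, e, ?_, ?_⟩
    · intro k hk
      simp only [Finset.coe_image, Set.mem_image] at hk
      obtain ⟨a, ha, rfl⟩ := hk
      have : (a, (g : Sinf) a) ∈ restr f e := hsub ⟨ha, rfl⟩
      show f ((g : Sinf)⁻¹ ((g : Sinf) a)) = (g : Sinf) a
      rw [perm_inv_apply]
      exact this.2
    · intro a ha
      have : (a, (g : Sinf) a) ∈ restr f e := hsub ⟨ha, rfl⟩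
      exact this.1
    · simp
  · rintro ⟨k, hk, e, hde, rfl⟩
    refine ⟨⟨_, (k * g).2, e, rfl⟩, ?_⟩
    rintro ⟨a, b⟩ ⟨ha, hab⟩
    refine ⟨hde ha, ?_⟩
    simp only at ha hab ⊢
    rw [← hab]
    exact hk _ (by simpa using ha)

theorem Vb_restr (g : G) (d : Finset ℕ) (f : G) :
    f ∈ Vb G (restr (g : Sinf) d) ↔
      f * g⁻¹ ∈ Vc G ((d.image (g : Sinf) : Finset ℕ) : Set ℕ) := by
  constructor
  · intro h k hk
    simp only [Finset.coe_image, Set.mem_image] at hk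
    obtain ⟨a, ha, rfl⟩ := hk
    show (f : Sinf) ((g : Sinf)⁻¹ ((g : Sinf) a)) = (g : Sinf) a
    rw [perm_inv_apply]
    exact h (a, (g : Sinf) a) ⟨ha, rfl⟩
  · rintro h ⟨a, b⟩ ⟨ha, hab⟩
    have := h ((g : Sinf) a) (by simpa using ha)
    change (f : Sinf) ((g : Sinf)⁻¹ ((g : Sinf) a)) = (g : Sinf) a at this
    rw [perm_inv_apply] at this
    exact this.trans hab

theorem mem_BsetOne [ContinuousConstSMul G X] {A : ℕ → Set X}
    (hbasis : TopologicalSpace.IsTopologicalBasis (Set.range A))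
    (g : G) (d : Finset ℕ) (x z : X) :
    z ∈ BsetOne G A (restr (g : Sinf) d) x ↔ baseR G (d.image (g : Sinf)) (g • x) z := by
  set c := d.image (g : Sinf) with hc
  have e1 : ∀ l, (setOrb G (Vb G (restr (g : Sinf) d)) x ∩ A l).Nonempty ↔
      ∃ k ∈ Vc G (c : Set ℕ), k • g • x ∈ A l := by
    intro l
    constructor
    · rintro ⟨_, ⟨f, hf, rfl⟩, h⟩
      exact ⟨f * g⁻¹, (Vb_restr g d f).1 hf, by simpa [smul_smul] using h⟩
    · rintro ⟨k, hk, h⟩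
      exact ⟨_, ⟨k * g, (Vb_restr g d _).2 (by rw [mul_inv_cancel_right]; exact hk), rfl⟩, by simpa [mul_smul] using h⟩
  have e2 : ∀ l, z ∈ setSmul G (Vc G (c : Set ℕ)) (A l) ↔
      ∃ k ∈ Vc G (c : Set ℕ), k • z ∈ A l := by
    intro l
    simp only [setSmul, Set.mem_iUnion, Set.mem_smul_set_iff_inv_smul_mem, exists_prop]
    constructor
    · rintro ⟨k, hk, h⟩
      exact ⟨k⁻¹, Vc_inv hk, h⟩
    · rintro ⟨k, hk, h⟩
      exact ⟨k⁻¹, Vc_inv hk, by simpa using h⟩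
  have e3 : z ∈ BsetOne G A (restr (g : Sinf) d) x ↔
      ∀ l, ((∃ k ∈ Vc G (c : Set ℕ), k • g • x ∈ A l) ↔ ∃ k ∈ Vc G (c : Set ℕ), k • z ∈ A l) := by
    simp only [BsetOne, Set.mem_inter_iff, Set.mem_iInter, prng_restr, ← hc, Set.mem_compl_iff,
      e1, e2, ← Set.not_nonempty_iff_eq_empty]
    constructor
    · rintro ⟨h1, h2⟩ l
      exact ⟨h1 l, fun h => by_contra fun h' => h2 l h' h⟩
    · intro h
      exact ⟨fun l => (h l).1, fun l hl h' => hl ((h l).2 h')⟩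
  rw [e3]
  constructor
  · intro h U hU
    constructor
    · rintro ⟨k, hk, hx⟩
      obtain ⟨_, ⟨l, rfl⟩, hl, hlU⟩ := hbasis.exists_subset_of_mem_open hx hU
      obtain ⟨k', hk', h'⟩ := (h l).1 ⟨k, hk, hl⟩
      exact ⟨k', hk', hlU h'⟩
    · rintro ⟨k, hk, hx⟩
      obtain ⟨_, ⟨l, rfl⟩, hl, hlU⟩ := hbasis.exists_subset_of_mem_open hx hU
      obtain ⟨k', hk', h'⟩ := (h l).2 ⟨k, hk, hl⟩
      exact ⟨k', hk', hlU h'⟩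
  · intro h l
    exact h _ (hbasis.isOpen ⟨l, rfl⟩)

theorem Bset_succ (A : ℕ → Set X) (o : Ordinal.{0}) :
    Bset G A (Order.succ o) = if o = 0 then BsetOne G A else BsetSucc G (Bset G A o) := by
  unfold Bset
  exact Ordinal.limitRecOn_add_one ..

theorem Bset_limit (A : ℕ → Set X) {o : Ordinal.{0}} (ho : Order.IsSuccLimit o) :
    Bset G A o = fun σ x => ⋂ β : Ordinal.{0}, ⋂ (_ : β < o), ⋂ (_ : 1 ≤ β), Bset G A β σ x := by
  unfold Bset
  rw [Ordinal.limitRecOn_limit _ _ _ _ ho]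

theorem mem_Bset [ContinuousConstSMul G X] {A : ℕ → Set X}
    (hbasis : TopologicalSpace.IsTopologicalBasis (Set.range A)) {α : Ordinal.{0}} :
    1 ≤ α → ∀ (g : G) (d : Finset ℕ) (x z : X),
    z ∈ Bset G A α (restr (g : Sinf) d) x ↔ RR G α (d.image (g : Sinf)) (g • x) z := by
  induction α using Ordinal.limitRecOn with
  | zero => intro h; simp at h
  | add_one o ih =>
    intro _ g d x z
    change z ∈ Bset G A (Order.succ o) _ _ ↔ RR G (Order.succ o) _ _ _
    rw [Bset_succ]
    split_ifs with h0
    · subst h0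
      rw [mem_BsetOne hbasis, RR_iff]
      refine ⟨fun h => ⟨h, fun β hβ h1 => ?_⟩, fun h => h.1⟩
      exact absurd (h1.trans (Order.lt_succ_iff.1 hβ)) (by simp)
    · have ho : 1 ≤ o := Ordinal.one_le_iff_ne_zero.2 h0
      have ih := ih ho
      rw [RR_succ_iff ho]
      simp only [BsetSucc, Set.mem_inter_iff, Set.mem_iInter, Set.mem_iUnion, exists_prop,
        pdom_restr, prng_restr]
      constructor
      · rintro ⟨h1, h2⟩ a ha
        constructor
        · have hd : (d : Set ℕ) ⊆ (a.image ((g⁻¹ : G) : Sinf) : Finset ℕ) := by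
            have := Finset.image_subset_image (f := ((g⁻¹ : G) : Sinf)) ha
            rw [image_image_inv] at this
            exact_mod_cast this
          obtain ⟨τ, hτ, hsub, hdom, hz⟩ := h1 _ hd
          obtain ⟨k, hk, e, hde, rfl⟩ := (ext_iff g d τ).1 ⟨hτ, hsub⟩
          rw [pdom_restr] at hdom
          have hdom : e = a.image ((g⁻¹ : G) : Sinf) := by exact_mod_cast hdom
          rw [ih, hdom, image_mul, image_inv_image] at hz
          have := RR_equiv k⁻¹ hz
          rw [image_image_inv] at this
          exact ⟨k⁻¹, Vc_inv hk, by simpa [mul_smul] using this⟩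
        · obtain ⟨τ, hτ, hsub, hrng, hz⟩ := h2 a (by exact_mod_cast ha)
          obtain ⟨k, hk, e, hde, rfl⟩ := (ext_iff g d τ).1 ⟨hτ, hsub⟩
          rw [prng_restr] at hrng
          have hrng : e.image ((k * g : G) : Sinf) = a := by exact_mod_cast hrng
          rw [ih, hrng] at hz
          exact ⟨k, hk, by simpa [mul_smul] using hz⟩
      · intro h
        constructor
        · intro b hb
          have hb : d ⊆ b := by exact_mod_cast hb
          obtain ⟨⟨k, hk, h2⟩, -⟩ := h (b.image (g : Sinf)) (Finset.image_subset_image hb)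
          obtain ⟨hτ, hsub⟩ := (ext_iff g d _).2 ⟨k⁻¹, Vc_inv hk, b, hb, rfl⟩
          refine ⟨_, hτ, hsub, pdom_restr _ _, ?_⟩
          rw [ih, image_mul]
          simpa [mul_smul] using RR_equiv k⁻¹ h2
        · intro a ha
          have ha : d.image (g : Sinf) ⊆ a := by exact_mod_cast ha
          obtain ⟨-, ⟨k, hk, h2⟩⟩ := h a ha
          have hde : d ⊆ a.image (((k * g)⁻¹ : G) : Sinf) := by
            have := Finset.image_subset_image (f := (((k * g)⁻¹ : G) : Sinf)) ha
            have hke : d.image ((k * g : G) : Sinf) = d.image (g : Sinf) := by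
              rw [image_mul, Vc_image hk]
            rwa [← hke, image_image_inv] at this
          obtain ⟨hτ, hsub⟩ := (ext_iff g d _).2 ⟨k, hk, _, hde, rfl⟩
          refine ⟨_, hτ, hsub, ?_, ?_⟩
          · rw [prng_restr, image_inv_image]
          · rw [ih, image_inv_image]
            simpa [mul_smul] using h2
  | limit o ho ih =>
    intro _ g d x z
    rw [Bset_limit A ho, RR_limit_iff ho]
    simp only [Set.mem_iInter]
    exact forall_congr' fun β => forall_congr' fun hβ => forall_congr' fun h1 =>
      ih β hβ h1 g d x z

theorem Bset_eq_iff [ContinuousConstSMul G X] {A : ℕ → Set X}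
    (hbasis : TopologicalSpace.IsTopologicalBasis (Set.range A)) {α : Ordinal.{0}}
    (hα : 1 ≤ α) (g h : G) (d e c : Finset ℕ) (hd : d.image (g : Sinf) = c)
    (he : e.image (h : Sinf) = c) (x y : X) :
    Bset G A α (restr (g : Sinf) d) x = Bset G A α (restr (h : Sinf) e) y ↔
      RR G α c (g • x) (h • y) := by
  constructor
  · intro H
    have : h • y ∈ Bset G A α (restr (h : Sinf) e) y := by
      rw [mem_Bset hbasis hα]; exact RR_refl _ _ _
    rw [← H, mem_Bset hbasis hα, hd] at this
    exact this
  · intro H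
    ext z
    rw [mem_Bset hbasis hα, mem_Bset hbasis hα, hd, he]
    exact ⟨fun h' => RR_trans (RR_symm H) h', fun h' => RR_trans H h'⟩

theorem fam_subset [ContinuousConstSMul G X] {A : ℕ → Set X}
    (hbasis : TopologicalSpace.IsTopologicalBasis (Set.range A)) {α ζ : Ordinal.{0}}
    (hζ : 1 ≤ ζ) (hζα : ζ < α) (g h : G) (d e c a : Finset ℕ) (hd : d.image (g : Sinf) = c)
    (he : e.image (h : Sinf) = c) (hca : c ⊆ a) (x y : X) (H : RR G α c (g • x) (h • y)) :
    {B | ∃ σ' ∈ SGfin G, restr (g : Sinf) d ⊆ σ' ∧ prng σ' = ↑a ∧ B = Bset G A ζ σ' x} ⊆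
      {B | ∃ σ' ∈ SGfin G, restr (h : Sinf) e ⊆ σ' ∧ prng σ' = ↑a ∧ B = Bset G A ζ σ' y} := by
  rintro B ⟨τ, hτ, hsub, hrng, rfl⟩
  obtain ⟨k, hk, d', hdd', rfl⟩ := (ext_iff g d τ).1 ⟨hτ, hsub⟩
  rw [prng_restr] at hrng
  have hrng : d'.image ((k * g : G) : Sinf) = a := by exact_mod_cast hrng
  rw [hd] at hk
  obtain ⟨⟨f, hf, h2⟩, -⟩ := (RR_iff.1 (RR_equiv_fix hk H)).2 ζ hζα hζ a hca
  have hfk := Vc_mul hf hk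
  have hde : e ⊆ a.image (((f * k * h)⁻¹ : G) : Sinf) := by
    have := Finset.image_subset_image (f := (((f * k * h)⁻¹ : G) : Sinf)) hca
    have hfe : e.image ((f * k * h : G) : Sinf) = c := by rw [image_mul, he, Vc_image hfk]
    rwa [← hfe, image_image_inv] at this
  obtain ⟨hτ', hsub'⟩ := (ext_iff h e _).2 ⟨f * k, by rw [he]; exact hfk, _, hde, rfl⟩
  refine ⟨_, hτ', hsub', ?_, ?_⟩
  · rw [prng_restr, image_inv_image]
  · rw [Bset_eq_iff hbasis hζ _ _ _ _ a hrng (image_inv_image _ _)]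
    simpa [mul_smul] using h2

theorem fam_exists [ContinuousConstSMul G X] {A : ℕ → Set X}
    (hbasis : TopologicalSpace.IsTopologicalBasis (Set.range A)) {ζ : Ordinal.{0}}
    (hζ : 1 ≤ ζ) (g h : G) (d e c a : Finset ℕ) (hd : d.image (g : Sinf) = c)
    (he : e.image (h : Sinf) = c) (hca : c ⊆ a) (x y : X)
    (H : {B | ∃ σ' ∈ SGfin G, restr (g : Sinf) d ⊆ σ' ∧ prng σ' = ↑a ∧ B = Bset G A ζ σ' x} ⊆
      {B | ∃ σ' ∈ SGfin G, restr (h : Sinf) e ⊆ σ' ∧ prng σ' = ↑a ∧ B = Bset G A ζ σ' y}) :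
    ∃ k ∈ Vc G (c : Set ℕ), RR G ζ a (g • x) (k • h • y) := by
  have hdd : d ⊆ a.image ((g⁻¹ : G) : Sinf) := by
    have := Finset.image_subset_image (f := ((g⁻¹ : G) : Sinf)) hca
    rwa [← hd, image_image_inv] at this
  obtain ⟨hτ, hsub⟩ := (ext_iff g d _).2 ⟨1, Vc_one _, _, hdd, rfl⟩
  rw [one_mul] at hτ hsub
  obtain ⟨τ, hτ', hsub', hrng, hB⟩ := H ⟨_, hτ, hsub, by rw [prng_restr, image_inv_image], rfl⟩
  obtain ⟨k, hk, e', hee', rfl⟩ := (ext_iff h e τ).1 ⟨hτ', hsub'⟩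
  rw [prng_restr] at hrng
  have hrng : e'.image ((k * h : G) : Sinf) = a := by exact_mod_cast hrng
  rw [Bset_eq_iff hbasis hζ _ _ _ _ a (image_inv_image _ _) hrng] at hB
  rw [he] at hk
  exact ⟨k, hk, by simpa [mul_smul] using hB⟩

end Aux

/-- Criterion for equality of α-sets. -/
theorem alphaSet_equality_criterion
    (G : Subgroup Sinf) (hGclosed : IsClosed (G : Set Sinf))
    {X : Type*} [TopologicalSpace X] [PolishSpace X] [MulAction G X] [ContinuousSMul G X]
    (A : ℕ → Set X) (hbasis : TopologicalSpace.IsTopologicalBasis (Set.range A))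
    (hbasisInv : ∀ l, ∃ c : Finset ℕ, ∀ g ∈ Vc G (↑c : Set ℕ), g • A l = A l)
    (x y : X) (σ δ : Set (ℕ × ℕ)) (hσ : σ ∈ SGfin G) (hδ : δ ∈ SGfin G)
    (c : Finset ℕ) (hc : prng σ = ↑c) (hc' : prng δ = ↑c)
    (α : Ordinal.{0}) (hα : 1 < α) (hαc : α.card ≤ Cardinal.aleph0) :
    (Bset G A α σ x = Bset G A α δ y ↔
      ∀ a : Finset ℕ, (↑c : Set ℕ) ⊆ ↑a → ∀ ζ : Ordinal.{0}, 1 ≤ ζ → ζ < α →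
        {B | ∃ σ' ∈ SGfin G, σ ⊆ σ' ∧ prng σ' = ↑a ∧ B = Bset G A ζ σ' x} =
          {B | ∃ δ' ∈ SGfin G, δ ⊆ δ' ∧ prng δ' = ↑a ∧ B = Bset G A ζ δ' y}) ∧
    (Bset G A α σ x = Bset G A α δ y ↔
      ∀ n : ℕ, (↑c : Set ℕ) ⊆ ↑(Finset.range n) → ∀ ζ : Ordinal.{0}, 1 ≤ ζ → ζ < α →
        {B | ∃ σ' ∈ SGfin G, σ ⊆ σ' ∧ prng σ' = ↑(Finset.range n) ∧ B = Bset G A ζ σ' x} =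
          {B | ∃ δ' ∈ SGfin G, δ ⊆ δ' ∧ prng δ' = ↑(Finset.range n) ∧ B = Bset G A ζ δ' y}) := by
  obtain ⟨g, hg, d, rfl⟩ := hσ
  obtain ⟨h, hh, e, rfl⟩ := hδ
  rw [prng_restr] at hc hc'
  have hd : d.image g = c := by exact_mod_cast hc
  have he : e.image h = c := by exact_mod_cast hc'
  clear hc hc'
  lift g to G using hg
  lift h to G using hh
  rw [Bset_eq_iff hbasis hα.le g h d e c hd he]
  have key1 : RR G α c (g • x) (h • y) →
      ∀ a : Finset ℕ, (↑c : Set ℕ) ⊆ ↑a → ∀ ζ : Ordinal.{0}, 1 ≤ ζ → ζ < α →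
        {B | ∃ σ' ∈ SGfin G, restr (g : Sinf) d ⊆ σ' ∧ prng σ' = ↑a ∧ B = Bset G A ζ σ' x} =
          {B | ∃ δ' ∈ SGfin G, restr (h : Sinf) e ⊆ δ' ∧ prng δ' = ↑a ∧ B = Bset G A ζ δ' y} := by
    intro H a ha ζ hζ hζα
    have ha : c ⊆ a := by exact_mod_cast ha
    exact Set.Subset.antisymm (fam_subset hbasis hζ hζα g h d e c a hd he ha x y H)
      (fam_subset hbasis hζ hζα h g e d c a he hd ha y x (RR_symm H))
  have key2 : (∀ n : ℕ, (↑c : Set ℕ) ⊆ ↑(Finset.range n) → ∀ ζ : Ordinal.{0}, 1 ≤ ζ → ζ < α →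
        {B | ∃ σ' ∈ SGfin G, restr (g : Sinf) d ⊆ σ' ∧ prng σ' = ↑(Finset.range n) ∧
          B = Bset G A ζ σ' x} =
          {B | ∃ δ' ∈ SGfin G, restr (h : Sinf) e ⊆ δ' ∧ prng δ' = ↑(Finset.range n) ∧
            B = Bset G A ζ δ' y}) → RR G α c (g • x) (h • y) := by
    intro H
    have step : ∀ ζ < α, 1 ≤ ζ → ∀ a : Finset ℕ, c ⊆ a →
        (∃ k ∈ Vc G (c : Set ℕ), RR G ζ a (g • x) (k • h • y)) ∧
        (∃ k ∈ Vc G (c : Set ℕ), RR G ζ a (k • g • x) (h • y)) := by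
      intro ζ hζα hζ a ha
      obtain ⟨n, hn⟩ := a.exists_nat_subset_range
      have hcn := ha.trans hn
      have E := H n (by exact_mod_cast hcn) ζ hζ hζα
      obtain ⟨k, hk, h1⟩ := fam_exists hbasis hζ g h d e c _ hd he hcn x y E.subset
      obtain ⟨k', hk', h2⟩ := fam_exists hbasis hζ h g e d c _ he hd hcn y x E.symm.subset
      exact ⟨⟨k, hk, RR_restrict hn h1⟩, ⟨k', hk', RR_symm (RR_restrict hn h2)⟩⟩
    rw [RR_iff]
    refine ⟨?_, step⟩
    obtain ⟨⟨k, hk, h1⟩, -⟩ := step 1 hα le_rfl c subset_rfl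
    exact baseR_trans (RR_iff.1 h1).1 (baseR_symm (baseR_smul hk))
  exact ⟨⟨key1, fun H => key2 fun n => H _⟩, ⟨fun H n => key1 H _, key2⟩⟩
end
end

section
/- Borel rank of suborbits: Let x ∈ X and suppose the orbit G·x belongs to Π⁰_α(X) for some countable ordinal α ≥ 1. Then for every finite set c ⊆ ℕ the orbit V^G_c·x belongs to Π⁰_α(X), and for every open subgroup H < G the orbit H·x belongs to Π⁰_{α+2}(X). -/
open Set Pointwise

noncomputable section

theorem sigmaB_one {X : Type*} [TopologicalSpace X] {α : Ordinal.{0}} (h : α ≤ 1) {s : Set X} :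
    s ∈ SigmaB X α ↔ IsOpen s := by
  rw [SigmaB, if_pos h]; rfl

theorem sigmaB_gt {X : Type*} [TopologicalSpace X] {α : Ordinal.{0}} (h : 1 < α) {s : Set X} :
    s ∈ SigmaB X α ↔ ∃ f : ℕ → Set X,
      (∀ n, ∃ β, β < α ∧ 1 ≤ β ∧ (f n)ᶜ ∈ SigmaB X β) ∧ s = ⋃ n, f n := by
  rw [SigmaB, if_neg (not_le.mpr h)]
  constructor
  · rintro ⟨f, hf, hs⟩
    refine ⟨f, fun n => ?_, hs⟩
    obtain ⟨β, h1, h2⟩ := hf n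
    exact ⟨β.1, β.2, h1, h2⟩
  · rintro ⟨f, hf, hs⟩
    refine ⟨f, fun n => ?_, hs⟩
    obtain ⟨β, h0, h1, h2⟩ := hf n
    exact ⟨⟨β, h0⟩, h1, h2⟩

theorem sigmaB_of_compl {X : Type*} [TopologicalSpace X] {α β : Ordinal.{0}} (h1 : 1 ≤ β)
    (h : β < α) {s : Set X} (hs : sᶜ ∈ SigmaB X β) : s ∈ SigmaB X α :=
  (sigmaB_gt (h1.trans_lt h)).2 ⟨fun _ => s, fun _ => ⟨β, h, h1, hs⟩, (iUnion_const s).symm⟩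

theorem sigmaB_of_isOpen {X : Type*} [TopologicalSpace X] [PolishSpace X] {α : Ordinal.{0}}
    {s : Set X} (hs : IsOpen s) : s ∈ SigmaB X α := by
  rcases le_or_gt α 1 with h | h
  · exact (sigmaB_one h).2 hs
  · letI := TopologicalSpace.upgradeIsCompletelyMetrizable X
    obtain ⟨F, hF, -, hU, -⟩ := hs.exists_iUnion_isClosed
    exact (sigmaB_gt h).2 ⟨F, fun n => ⟨1, h, le_rfl, (sigmaB_one le_rfl).2 (hF n).isOpen_compl⟩,
      hU.symm⟩

theorem sigmaB_mono {X : Type*} [TopologicalSpace X] [PolishSpace X] {α β : Ordinal.{0}}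
    (h : β ≤ α) : SigmaB X β ⊆ SigmaB X α := by
  intro s hs
  rcases le_or_gt β 1 with h1 | h1
  · exact sigmaB_of_isOpen ((sigmaB_one h1).1 hs)
  · obtain ⟨f, hf, rfl⟩ := (sigmaB_gt h1).1 hs
    refine (sigmaB_gt (h1.trans_le h)).2 ⟨f, fun n => ?_, rfl⟩
    obtain ⟨β, h0, h2⟩ := hf n
    exact ⟨β, h0.trans_le h, h2⟩

theorem sigmaB_iUnion {X : Type*} [TopologicalSpace X] {α : Ordinal.{0}}
    {f : ℕ → Set X} (hf : ∀ n, f n ∈ SigmaB X α) : ⋃ n, f n ∈ SigmaB X α := by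
  rcases le_or_gt α 1 with h | h
  · exact (sigmaB_one h).2 (isOpen_iUnion fun n => (sigmaB_one h).1 (hf n))
  · choose g hg hfg using fun n => (sigmaB_gt h).1 (hf n)
    refine (sigmaB_gt h).2 ⟨fun k => g k.unpair.1 k.unpair.2, fun k => hg _ _, ?_⟩
    rw [Set.iUnion_unpair (fun i j => g i j)]
    exact iUnion_congr hfg

theorem sigmaB_empty {X : Type*} [TopologicalSpace X] [PolishSpace X] {α : Ordinal.{0}} :
    (∅ : Set X) ∈ SigmaB X α := sigmaB_of_isOpen isOpen_empty

theorem sigmaB_iUnion' {X : Type*} [TopologicalSpace X] [PolishSpace X] {α : Ordinal.{0}}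
    {ι : Type*} [Countable ι]
    {f : ι → Set X} (hf : ∀ n, f n ∈ SigmaB X α) : ⋃ n, f n ∈ SigmaB X α := by
  rcases isEmpty_or_nonempty ι with h | h
  · rw [iUnion_of_empty]; exact sigmaB_empty
  · obtain ⟨e, he⟩ := exists_surjective_nat ι
    rw [← he.iUnion_comp]
    exact sigmaB_iUnion fun n => hf _

theorem sigmaB_union {X : Type*} [TopologicalSpace X] [PolishSpace X] {α : Ordinal.{0}}
    {s t : Set X} (hs : s ∈ SigmaB X α) (ht : t ∈ SigmaB X α) : s ∪ t ∈ SigmaB X α := by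
  rw [union_eq_iUnion]
  exact sigmaB_iUnion' (by rintro (_ | _) <;> simpa)

theorem sigmaB_inter {X : Type*} [TopologicalSpace X] [PolishSpace X] {α : Ordinal.{0}}
    {s t : Set X} (hs : s ∈ SigmaB X α) (ht : t ∈ SigmaB X α) : s ∩ t ∈ SigmaB X α := by
  rcases le_or_gt α 1 with h | h
  · exact (sigmaB_one h).2 (((sigmaB_one h).1 hs).inter ((sigmaB_one h).1 ht))
  · obtain ⟨f, hf, rfl⟩ := (sigmaB_gt h).1 hs
    obtain ⟨g, hg, rfl⟩ := (sigmaB_gt h).1 ht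
    rw [iUnion_inter_iUnion]
    refine sigmaB_iUnion' fun p => ?_
    refine sigmaB_iUnion' fun q => ?_
    obtain ⟨β, h1, h2, h3⟩ := hf p
    obtain ⟨γ, h1', h2', h3'⟩ := hg q
    refine sigmaB_of_compl (β := max β γ) (h2.trans (le_max_left _ _)) (max_lt h1 h1') ?_
    rw [compl_inter]
    exact sigmaB_union (sigmaB_mono (le_max_left _ _) h3) (sigmaB_mono (le_max_right _ _) h3')

theorem sigmaB_sInter {X : Type*} [TopologicalSpace X] [PolishSpace X] {α : Ordinal.{0}}
    {F : Set (Set X)} (hF : F.Finite) (h : ∀ s ∈ F, s ∈ SigmaB X α) : ⋂₀ F ∈ SigmaB X α := by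
  induction F, hF using Set.Finite.induction_on with
  | empty => rw [sInter_empty]; exact sigmaB_of_isOpen isOpen_univ
  | insert _ _ ih =>
    rw [sInter_insert]
    exact sigmaB_inter (h _ (mem_insert _ _)) (ih fun s hs => h s (mem_insert_of_mem _ hs))

/-- A topology generated by countably many `Σ⁰_α` sets consists of `Σ⁰_α` sets. -/
theorem sigmaB_of_generateFrom {X : Type*} [TopologicalSpace X] [PolishSpace X] {α : Ordinal.{0}}
    {S : Set (Set X)} (hS : S.Countable) (h : ∀ s ∈ S, s ∈ SigmaB X α) {u : Set X}
    (hu : @IsOpen X (TopologicalSpace.generateFrom S) u) : u ∈ SigmaB X α := by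
  have hb := @TopologicalSpace.isTopologicalBasis_of_subbasis X (TopologicalSpace.generateFrom S)
    S rfl
  obtain ⟨F, hF, rfl⟩ := @TopologicalSpace.IsTopologicalBasis.open_eq_sUnion X
    (TopologicalSpace.generateFrom S) _ hb u hu
  have hc : F.Countable :=
    ((Set.countable_setOf_finite_subset hS).image _).mono hF
  rw [sUnion_eq_iUnion]
  haveI := hc.to_subtype
  refine sigmaB_iUnion' ?_
  rintro ⟨s, hs⟩
  obtain ⟨f, ⟨hf, hfS⟩, rfl⟩ := hF hs
  exact sigmaB_sInter hf fun s hs => h s (hfS hs)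

theorem sigmaB_measurable {X : Type*} [TopologicalSpace X] [MeasurableSpace X] [BorelSpace X]
    (α : Ordinal.{0}) : ∀ s ∈ SigmaB X α, MeasurableSet s := by
  induction α using WellFoundedLT.induction with
  | ind α ih =>
    intro s hs
    rcases le_or_gt α 1 with h | h
    · exact ((sigmaB_one h).1 hs).measurableSet
    · obtain ⟨f, hf, rfl⟩ := (sigmaB_gt h).1 hs
      refine MeasurableSet.iUnion fun n => ?_
      obtain ⟨β, h1, h2, h3⟩ := hf n
      exact (ih β h1 _ h3).of_compl

/-- Countable hereditary families of codes. -/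
def HerFam (X : Type*) [TopologicalSpace X] (α : Ordinal.{0}) (F : Set (Ordinal.{0} × Set X)) :
    Prop :=
  F.Countable ∧ ∀ p ∈ F, 1 ≤ p.1 ∧ p.1 < α ∧ p.2 ∈ SigmaB X p.1 ∧
    (IsOpen p.2 ∨ ∃ q : ℕ → Ordinal.{0} × Set X, (∀ n, q n ∈ F ∧ (q n).1 < p.1) ∧
      p.2 = ⋃ n, (q n).2ᶜ)

theorem HerFam.iUnion {X : Type*} [TopologicalSpace X] {α : Ordinal.{0}}
    {F : ℕ → Set (Ordinal.{0} × Set X)} (h : ∀ n, HerFam X α (F n)) : HerFam X α (⋃ n, F n) := by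
  refine ⟨countable_iUnion fun n => (h n).1, fun p hp => ?_⟩
  obtain ⟨n, hn⟩ := mem_iUnion.1 hp
  obtain ⟨h1, h2, h3, h4⟩ := (h n).2 p hn
  refine ⟨h1, h2, h3, h4.imp_right ?_⟩
  rintro ⟨q, hq, e⟩
  exact ⟨q, fun m => ⟨mem_iUnion.2 ⟨n, (hq m).1⟩, (hq m).2⟩, e⟩

theorem exists_herFam {X : Type*} [TopologicalSpace X] {α : Ordinal.{0}} (β : Ordinal.{0}) :
    ∀ s ∈ SigmaB X β, 1 ≤ β → β < α → ∃ F, HerFam X α F ∧ (β, s) ∈ F := by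
  induction β using WellFoundedLT.induction with
  | ind β ih =>
    intro s hs h1 hα
    rcases h1.eq_or_lt with h | h
    · refine ⟨{(β, s)}, ⟨countable_singleton _, ?_⟩, rfl⟩
      rintro p rfl
      exact ⟨h1, hα, hs, Or.inl ((sigmaB_one h.ge).1 hs)⟩
    · obtain ⟨f, hf, e⟩ := (sigmaB_gt h).1 hs
      choose b hb1 hb2 hb3 using hf
      choose F hF hFm using fun n => ih (b n) (hb1 n) _ (hb3 n) (hb2 n) ((hb1 n).trans hα)
      have hU := HerFam.iUnion hF
      refine ⟨insert (β, s) (⋃ n, F n), ⟨hU.1.insert _, ?_⟩, mem_insert _ _⟩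
      rintro p (rfl | hp)
      · refine ⟨h1, hα, hs, Or.inr ⟨fun n => (b n, (f n)ᶜ), fun n => ⟨Or.inr (mem_iUnion.2
          ⟨n, hFm n⟩), hb1 n⟩, ?_⟩⟩
        simpa using e
      · obtain ⟨h1, h2, h3, h4⟩ := hU.2 p hp
        refine ⟨h1, h2, h3, h4.imp_right ?_⟩
        rintro ⟨q, hq, e⟩
        exact ⟨q, fun m => ⟨Or.inr (hq m).1, (hq m).2⟩, e⟩

theorem not_isMeagre_of_open {Y : Type*} [TopologicalSpace Y] [BaireSpace Y] {U : Set Y}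
    (hU : IsOpen U) (hne : U.Nonempty) : ¬ IsMeagre U := by
  intro h
  obtain ⟨y, hy, hy'⟩ := (dense_of_mem_residual h).inter_open_nonempty U hU hne
  exact hy' hy

/-- A non-meagre set with the Baire property is comeagre in a non-empty open set. -/
theorem exists_open_of_not_isMeagre {Y : Type*} [TopologicalSpace Y] {S : Set Y}
    (hS : BaireMeasurableSet S) (hm : ¬ IsMeagre S) :
    ∃ O : Set Y, IsOpen O ∧ O.Nonempty ∧ IsMeagre (O \ S) := by
  obtain ⟨O, hO, he⟩ := hS.residualEq_isOpen
  have he' := Filter.eventuallyEq_set.1 he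
  refine ⟨O, hO, ?_, ?_⟩
  · by_contra hne
    rw [not_nonempty_iff_eq_empty] at hne
    apply hm
    subst hne
    show Sᶜ ∈ residual Y
    filter_upwards [he'] with y hy using by simpa using hy
  · show (O \ S)ᶜ ∈ residual Y
    filter_upwards [he'] with y hy
    simp only [mem_compl_iff, mem_diff]
    tauto

theorem gdelta_baire {Z : Type*} [TopologicalSpace Z] [PolishSpace Z] {s : Set Z} (hs : IsGδ s) :
    BaireSpace s := by
  have h1 : PolishSpace (closure s) := isClosed_closure.polishSpace
  have h2 : IsGδ ((↑) ⁻¹' s : Set (closure s)) := hs.preimage continuous_subtype_val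
  have h3 : Dense ((↑) ⁻¹' s : Set (closure s)) := by
    rw [Subtype.dense_iff]
    intro z hz
    have : ((↑) '' ((↑) ⁻¹' s : Set (closure s)) : Set Z) = s := by
      rw [Subtype.image_preimage_coe]
      exact inter_eq_right.2 subset_closure
    rw [this]; exact hz
  have h4 := h2.baireSpace_of_dense h3
  let e : ((↑) ⁻¹' s : Set (closure s)) ≃ₜ s :=
    { toFun := fun z => ⟨z.1.1, z.2⟩
      invFun := fun z => ⟨⟨z.1, subset_closure z.2⟩, z.2⟩
      left_inv := fun _ => rfl
      right_inv := fun _ => rfl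
      continuous_toFun := by fun_prop
      continuous_invFun := by fun_prop }
  exact e.baireSpace

/-- Effros-type lemma. -/
theorem effros_open {G Y : Type*} [Group G] [TopologicalSpace Y] [BaireSpace Y] [MulAction G Y]
    (hc : ∀ g : G, Continuous fun y : Y => g • y) (htr : ∀ y z : Y, ∃ g : G, g • y = z)
    (H : Subgroup G) (Q : Set G) (hQ : Q.Countable) (hQH : ∀ g : G, ∃ q ∈ Q, q⁻¹ * g ∈ H)
    (hB : ∀ y : Y, BaireMeasurableSet ((fun g : G => g • y) '' (H : Set G))) (y : Y) :
    IsOpen ((fun g : G => g • y) '' (H : Set G))ᶜ := by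
  have hmeag : ∀ (g : G) (S : Set Y), IsMeagre S → IsMeagre ((fun y : Y => g • y) ⁻¹' S) := by
    intro g S hS
    let e : Y ≃ₜ Y :=
      { toFun := fun y => g • y
        invFun := fun y => g⁻¹ • y
        left_inv := fun y => by simp
        right_inv := fun y => by simp
        continuous_toFun := hc g
        continuous_invFun := hc g⁻¹ }
    exact hS.preimage_of_isOpenMap (hc g) e.isOpenMap
  have hnm : ∀ y : Y, ¬ IsMeagre ((fun g : G => g • y) '' (H : Set G)) := by
    intro y hm
    have : IsMeagre (⋃ q ∈ Q, (fun z : Y => q⁻¹ • z) ⁻¹' ((fun g : G => g • y) '' (H : Set G))) :=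
      isMeagre_biUnion hQ fun q _ => hmeag _ _ hm
    refine not_isMeagre_of_open isOpen_univ ⟨y, trivial⟩ (this.mono ?_)
    intro z _
    obtain ⟨g, rfl⟩ := htr y z
    obtain ⟨q, hq, hqg⟩ := hQH g
    refine mem_iUnion₂.2 ⟨q, hq, q⁻¹ * g, hqg, ?_⟩
    simp [mul_smul]
  have hloc : ∀ y : Y, ∃ O : Set Y, IsOpen O ∧ y ∈ O ∧
      IsMeagre (O \ ((fun g : G => g • y) '' (H : Set G))) := by
    intro y
    obtain ⟨O, hO, hne, hm⟩ := exists_open_of_not_isMeagre (hB y) (hnm y)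
    have : (O ∩ ((fun g : G => g • y) '' (H : Set G))).Nonempty := by
      by_contra hne'
      rw [not_nonempty_iff_eq_empty] at hne'
      refine not_isMeagre_of_open hO hne (hm.mono ?_)
      intro z hz
      exact ⟨hz, fun h => (hne' ▸ (⟨hz, h⟩ : z ∈ O ∩ _) : z ∈ (∅ : Set Y))⟩
    obtain ⟨_, hz, h, hh, rfl⟩ := this
    refine ⟨(fun z : Y => h • z) ⁻¹' O, hO.preimage (hc h), hz, (hmeag h _ hm).mono ?_⟩
    rintro z ⟨hz1, hz2⟩
    refine ⟨hz1, ?_⟩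
    rintro ⟨k, hk, e⟩
    apply hz2
    refine ⟨h⁻¹ * k, H.mul_mem (H.inv_mem hh) hk, ?_⟩
    have e' : k • y = h • z := e
    simp [mul_smul, e']
  rw [isOpen_iff_forall_mem_open]
  intro z hz
  obtain ⟨O, hO, hzO, hm⟩ := hloc z
  refine ⟨O, ?_, hO, hzO⟩
  rintro _ hw ⟨h, hh, rfl⟩
  obtain ⟨O', hO', hO'm, hm'⟩ := hloc (h • y)
  refine not_isMeagre_of_open (hO.inter hO') ⟨_, hw, hO'm⟩ ((hm.union hm').mono ?_)
  rintro w ⟨hw1, hw2⟩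
  by_cases h1 : w ∈ ((fun g : G => g • z) '' (H : Set G))
  · right
    refine ⟨hw2, ?_⟩
    rintro ⟨k, hk, e⟩
    obtain ⟨l, hl, rfl⟩ := h1
    apply hz
    refine ⟨l⁻¹ * k * h, H.mul_mem (H.mul_mem (H.inv_mem hl) hk) hh, ?_⟩
    have e' : k • h • y = l • z := e
    simp [mul_smul, e']
  · exact Or.inl ⟨hw1, h1⟩

/-- A countable, right-invariant base of non-empty open sets. -/
structure GoodB {G : Type*} [Group G] [TopologicalSpace G] (W : Set (Set G)) : Prop where
  ctb : W.Countable
  opn : ∀ U ∈ W, IsOpen U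
  ne : ∀ U ∈ W, U.Nonempty
  base : ∀ (O : Set G), IsOpen O → ∀ g ∈ O, ∃ U ∈ W, g ∈ U ∧ U ⊆ O
  tr : ∀ U ∈ W, ∀ g : G, (fun h : G => h * g⁻¹) ⁻¹' U ∈ W

section Vaught

variable {G : Type*} [Group G] [TopologicalSpace G] [IsTopologicalGroup G] [PolishSpace G]
  {X : Type*} [TopologicalSpace X] [PolishSpace X] [MulAction G X] [ContinuousSMul G X]

/-- Vaught transform. -/
def DD (B : Set X) (W : Set G) : Set X := {y | ¬ IsMeagre {g : G | g ∈ W ∧ g • y ∈ B}}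

theorem DD_smul (B : Set X) (W : Set G) (g : G) (y : X) :
    g • y ∈ DD B W ↔ y ∈ DD B ((fun h : G => h * g⁻¹) ⁻¹' W) := by
  unfold DD
  simp only [mem_setOf_eq, not_iff_not]
  constructor
  · intro h
    refine (h.preimage_of_isOpenMap (Homeomorph.mulRight g⁻¹).continuous
      (Homeomorph.mulRight g⁻¹).isOpenMap).mono ?_
    rintro k ⟨h1, h2⟩
    exact ⟨h1, by simpa [smul_smul] using h2⟩
  · intro h
    refine (h.preimage_of_isOpenMap (Homeomorph.mulRight g).continuous
      (Homeomorph.mulRight g).isOpenMap).mono ?_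
    rintro k ⟨h1, h2⟩
    refine ⟨?_, ?_⟩
    · simpa using h1
    · simpa [mul_smul] using h2

theorem DD_open {B : Set X} (hB : IsOpen B) {W : Set G} (hW : IsOpen W) :
    IsOpen (DD B W : Set X) := by
  have : DD B W = ⋃ g ∈ W, (fun y : X => g • y) ⁻¹' B := by
    ext y
    simp only [DD, mem_setOf_eq, mem_iUnion, mem_preimage, exists_prop]
    constructor
    · intro h
      exact nonempty_of_not_isMeagre h
    · intro h
      refine not_isMeagre_of_open ?_ h
      exact hW.inter (hB.preimage (continuous_id.smul continuous_const))
  rw [this]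
  exact isOpen_biUnion fun g _ => hB.preimage (continuous_const_smul g)

theorem vaught_key {WW : Set (Set G)} (hWW : GoodB WW) {S : Set G} (hS : BaireMeasurableSet S)
    {W : Set G} (hW : IsOpen W) :
    ¬ IsMeagre {g | g ∈ W ∧ g ∉ S} ↔ ∃ W' ∈ WW, W' ⊆ W ∧ IsMeagre {g | g ∈ W' ∧ g ∈ S} := by
  constructor
  · intro h
    obtain ⟨O, hO, hne, hm⟩ := exists_open_of_not_isMeagre
      (S := {g | g ∈ W ∧ g ∉ S}) (hW.baireMeasurableSet.inter hS.compl) h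
    have : (O ∩ W).Nonempty := by
      by_contra hne'
      rw [not_nonempty_iff_eq_empty] at hne'
      refine not_isMeagre_of_open hO hne (hm.mono ?_)
      intro z hz
      exact ⟨hz, fun h => (hne' ▸ (⟨hz, h.1⟩ : z ∈ O ∩ _) : z ∈ (∅ : Set G))⟩
    obtain ⟨g, hg⟩ := this
    obtain ⟨U, hU, -, hUs⟩ := hWW.base _ (hO.inter hW) g hg
    refine ⟨U, hU, fun k hk => (hUs hk).2, hm.mono ?_⟩
    rintro k ⟨hk, hkS⟩
    exact ⟨(hUs hk).1, fun h => h.2 hkS⟩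
  · rintro ⟨U, hU, hUW, hm⟩ hm'
    refine not_isMeagre_of_open (hWW.opn U hU) (hWW.ne U hU) ((hm.union hm').mono ?_)
    intro k hk
    by_cases h : k ∈ S
    · exact Or.inl ⟨hk, h⟩
    · exact Or.inr ⟨hUW hk, h⟩

theorem orbit_baire {B : Set X} {β : Ordinal.{0}} (hB : B ∈ SigmaB X β) (y : X) :
    BaireMeasurableSet {g : G | g • y ∈ B} := by
  borelize X
  borelize G
  have h1 : Measurable fun g : G => g • y :=
    (continuous_id.smul continuous_const : Continuous fun g : G => g • y).measurable
  exact (h1 (sigmaB_measurable β B hB)).baireMeasurableSet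

theorem DD_union {WW : Set (Set G)} (hWW : GoodB WW) {q : ℕ → Ordinal.{0} × Set X}
    (hq : ∀ n, (q n).2 ∈ SigmaB X (q n).1) {W : Set G} (hW : IsOpen W) (y : X) :
    y ∈ DD (⋃ n, (q n).2ᶜ) W ↔ ∃ n, ∃ W' ∈ WW, W' ⊆ W ∧ y ∉ DD (q n).2 W' := by
  have h1 : ∀ n, (¬ IsMeagre {g : G | g ∈ W ∧ g • y ∈ (q n).2ᶜ}) ↔
      ∃ W' ∈ WW, W' ⊆ W ∧ y ∉ DD (q n).2 W' := by
    intro n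
    have := vaught_key hWW (orbit_baire (G := G) (hq n) y) hW
    simpa [DD] using this
  simp only [← h1]
  constructor
  · intro h
    by_contra! hcon
    apply h
    refine (isMeagre_iUnion hcon).mono ?_
    rintro g ⟨hg, hgy⟩
    obtain ⟨n, hn⟩ := mem_iUnion.1 hgy
    exact mem_iUnion.2 ⟨n, hg, hn⟩
  · rintro ⟨n, hn⟩ hm
    apply hn
    refine hm.mono ?_
    rintro g ⟨hg, hgy⟩
    exact ⟨hg, mem_iUnion.2 ⟨n, hgy⟩⟩

theorem DD_sigma {WW : Set (Set G)} (hWW : GoodB WW) {α : Ordinal.{0}}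
    {F : Set (Ordinal.{0} × Set X)} (hF : HerFam X α F) (β : Ordinal.{0}) :
    ∀ B : Set X, (β, B) ∈ F → ∀ W ∈ WW, DD B W ∈ SigmaB X β := by
  induction β using WellFoundedLT.induction with
  | ind β ih =>
    intro B hB W hW
    obtain ⟨h1, h2, h3, h4 | ⟨q, hq, e⟩⟩ := hF.2 _ hB
    · exact sigmaB_of_isOpen (DD_open h4 (hWW.opn W hW))
    · have e' : B = ⋃ n, (q n).2ᶜ := e
      haveI : Countable {U // U ∈ WW ∧ U ⊆ W} :=
        (hWW.ctb.mono (fun U (hU : U ∈ {U | U ∈ WW ∧ U ⊆ W}) => hU.1)).to_subtype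
      have : DD B W = ⋃ n, ⋃ U : {U // U ∈ WW ∧ U ⊆ W}, (DD (q n).2 U.1)ᶜ := by
        ext y
        rw [e', DD_union hWW (fun n => (hF.2 _ (hq n).1).2.2.1) (hWW.opn W hW)]
        simp only [mem_iUnion, mem_compl_iff, Subtype.exists, exists_prop, and_assoc]
      rw [this]
      refine sigmaB_iUnion' fun n => sigmaB_iUnion' fun U => ?_
      refine sigmaB_of_compl (β := (q n).1) (hF.2 _ (hq n).1).1 (hq n).2 ?_
      rw [compl_compl]
      exact ih _ (hq n).2 _ (hq n).1 _ U.2.1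

open Classical in
/-- The coding map. -/
def phi (F : Set (Ordinal.{0} × Set X)) (WW : Set (Set G)) (y : X) : X × ((F ×ˢ WW : Set _) → Bool) :=
  (y, fun j => decide (y ∈ DD j.1.1.2 j.1.2))

theorem phi_snd (F : Set (Ordinal.{0} × Set X)) (WW : Set (Set G)) (y : X)
    (j : (F ×ˢ WW : Set _)) : (phi F WW y).2 j = true ↔ y ∈ DD j.1.1.2 j.1.2 := by
  simp [phi]

theorem phi_range_gdelta {WW : Set (Set G)} (hWW : GoodB WW) {α : Ordinal.{0}}
    {F : Set (Ordinal.{0} × Set X)} (hF : HerFam X α F) : IsGδ (range (phi F WW)) := by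
  haveI : Countable (F ×ˢ WW : Set _) := (hF.1.prod hWW.ctb).to_subtype
  have key : ∀ j : (F ×ˢ WW : Set _), ∃ Q : Set (X × ((F ×ˢ WW : Set _) → Bool)), IsOpen Q ∧
      ∀ z, (∀ j' : (F ×ˢ WW : Set _), j'.1.1.1 < j.1.1.1 →
        (z.2 j' = true ↔ z.1 ∈ DD j'.1.1.2 j'.1.2)) → (z ∈ Q ↔ z.1 ∈ DD j.1.1.2 j.1.2) := by
    rintro ⟨⟨⟨β, B⟩, W⟩, hB, hW⟩
    have hB : (β, B) ∈ F := hB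
    have hW : W ∈ WW := hW
    obtain ⟨h1, h2, h3, h4 | ⟨q, hq, e⟩⟩ := hF.2 _ hB
    · exact ⟨Prod.fst ⁻¹' (DD B W), (DD_open h4 (hWW.opn W hW)).preimage continuous_fst,
        fun z _ => Iff.rfl⟩
    · have e' : B = ⋃ n, (q n).2ᶜ := e
      refine ⟨⋃ n, ⋃ U : {U // U ∈ WW ∧ U ⊆ W},
        {z | z.2 ⟨(q n, U.1), ⟨(hq n).1, U.2.1⟩⟩ = false}, ?_, ?_⟩
      · refine isOpen_iUnion fun n => isOpen_iUnion fun U => ?_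
        have hcc : Continuous fun z : X × ((F ×ˢ WW : Set _) → Bool) =>
            z.2 ⟨(q n, U.1), ⟨(hq n).1, U.2.1⟩⟩ := by fun_prop
        exact (isOpen_discrete {false}).preimage hcc
      · intro z hz
        show _ ↔ z.1 ∈ DD B W
        rw [e', DD_union hWW (fun n => (hF.2 _ (hq n).1).2.2.1) (hWW.opn W hW)]
        have h5 : ∀ n (U : {U // U ∈ WW ∧ U ⊆ W}),
            z.2 ⟨(q n, U.1), ⟨(hq n).1, U.2.1⟩⟩ = false ↔ z.1 ∉ DD (q n).2 U.1 := by
          intro n U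
          rw [← hz ⟨(q n, U.1), ⟨(hq n).1, U.2.1⟩⟩ (hq n).2]
          simp
        simp only [mem_iUnion, mem_setOf_eq, h5, Subtype.exists, exists_prop, and_assoc]
  choose Q hQ hQz using key
  have : range (phi F WW) = ⋂ j, {z | z.2 j = true ↔ z ∈ Q j} := by
    ext z
    simp only [mem_range, mem_iInter, mem_setOf_eq]
    constructor
    · rintro ⟨y, rfl⟩ j
      rw [hQz j _ (fun j' _ => phi_snd F WW y j')]
      exact phi_snd F WW y j
    · intro hz
      have hind : ∀ (β : Ordinal.{0}) (j : (F ×ˢ WW : Set _)), j.1.1.1 = β →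
          (z.2 j = true ↔ z.1 ∈ DD j.1.1.2 j.1.2) := by
        intro β
        induction β using WellFoundedLT.induction with
        | ind β ih =>
          rintro j rfl
          rw [hz j]
          exact hQz j z fun j' hj' => ih _ hj' j' rfl
      refine ⟨z.1, Prod.ext rfl (funext fun j => ?_)⟩
      rw [Bool.eq_iff_iff, phi_snd, hind _ j rfl]
  rw [this]
  letI := TopologicalSpace.upgradeIsCompletelyMetrizable (X × ((F ×ˢ WW : Set _) → Bool))
  refine IsGδ.iInter fun j => ?_
  have hcl : IsClopen {z : X × ((F ×ˢ WW : Set _) → Bool) | z.2 j = true} :=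
    (isClopen_discrete {true}).preimage ((continuous_apply j).comp continuous_snd)
  have : {z : X × ((F ×ˢ WW : Set _) → Bool) | z.2 j = true ↔ z ∈ Q j} =
      ({z | z.2 j = true} ∩ Q j) ∪ ({z | z.2 j = true}ᶜ ∩ (Q j)ᶜ) := by
    ext z
    simp only [mem_setOf_eq, mem_union, mem_inter_iff, mem_compl_iff]
    tauto
  rw [this]
  exact (hcl.isOpen.isGδ.inter (hQ j).isGδ).union
    (hcl.compl.isOpen.isGδ.inter (hQ j).isClosed_compl.isGδ)

theorem phi_cont {Y : Type*} [TopologicalSpace Y] (F : Set (Ordinal.{0} × Set X))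
    (WW : Set (Set G)) (f : Y → X) (hf : Continuous f)
    (h : ∀ j : (F ×ˢ WW : Set _), IsOpen (f ⁻¹' DD j.1.1.2 j.1.2) ∧
      IsOpen (f ⁻¹' (DD j.1.1.2 j.1.2)ᶜ)) : Continuous fun y => phi F WW (f y) := by
  refine Continuous.prodMk hf ?_
  refine continuous_pi fun j => ?_
  rw [continuous_discrete_rng]
  intro v
  cases v
  · convert (h j).2 using 1
    ext y
    simp
  · convert (h j).1 using 1
    ext y
    simp

/-- Sets open in the refined topology are `Σ⁰_α`. -/
theorem phi_open_sigma {WW : Set (Set G)} (hWW : GoodB WW) {α : Ordinal.{0}}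
    {F : Set (Ordinal.{0} × Set X)} (hF : HerFam X α F)
    {O : Set (X × ((F ×ˢ WW : Set _) → Bool))} (hO : IsOpen O) :
    phi F WW ⁻¹' O ∈ SigmaB X α := by
  haveI : Countable (F ×ˢ WW : Set _) := (hF.1.prod hWW.ctb).to_subtype
  obtain ⟨b, hbc, -, hb⟩ := TopologicalSpace.exists_countable_basis X
  let S : Set (Set X) := b ∪ ((range fun j : (F ×ˢ WW : Set _) => DD j.1.1.2 j.1.2) ∪
    (range fun j : (F ×ˢ WW : Set _) => (DD j.1.1.2 j.1.2)ᶜ))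
  have hS : S.Countable := hbc.union ((countable_range _).union (countable_range _))
  refine sigmaB_of_generateFrom hS ?_ ?_
  · rintro s (hs | ⟨⟨⟨⟨β, B⟩, W⟩, hB, hW⟩, rfl⟩ | ⟨⟨⟨⟨β, B⟩, W⟩, hB, hW⟩, rfl⟩)
    · exact sigmaB_of_isOpen (hb.isOpen hs)
    · exact sigmaB_mono (hF.2 _ hB).2.1.le (DD_sigma hWW hF β B hB W hW)
    · refine sigmaB_of_compl (hF.2 _ hB).1 (hF.2 _ hB).2.1 ?_
      rw [compl_compl]
      exact DD_sigma hWW hF β B hB W hW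
  · have hc : @Continuous _ _ (TopologicalSpace.generateFrom S) _ (phi F WW) := by
      refine @phi_cont _ _ _ _ _ _ _ _ _ _ _ (TopologicalSpace.generateFrom S) F WW id ?_ ?_
      · refine (@TopologicalSpace.IsTopologicalBasis.continuous_iff _ _ (_) (_) _ hb _).2
          fun s hs => ?_
        exact TopologicalSpace.isOpen_generateFrom_of_mem (Or.inl hs)
      · intro j
        exact ⟨TopologicalSpace.isOpen_generateFrom_of_mem (Or.inr (Or.inl ⟨j, rfl⟩)),
          TopologicalSpace.isOpen_generateFrom_of_mem (Or.inr (Or.inr ⟨j, rfl⟩))⟩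
    exact @IsOpen.preimage _ _ (_) (_) _ hc _ hO

end Vaught

section Main

variable {G : Type*} [Group G] [TopologicalSpace G] [IsTopologicalGroup G] [PolishSpace G]
  {X : Type*} [TopologicalSpace X] [PolishSpace X] [MulAction G X] [ContinuousSMul G X]

/-- The family refining the topology enough for the orbit to become closed. -/
theorem exists_family {WW : Set (Set G)} (hWW : GoodB WW) (x : X) (α : Ordinal.{0})
    (horb : MulAction.orbit G x ∈ PiB X α) :
    ∃ F, HerFam X α F ∧ ∃ C : Set (X × ((F ×ˢ WW : Set _) → Bool)), IsClosed C ∧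
      MulAction.orbit G x = phi F WW ⁻¹' C := by
  rcases le_or_gt α 1 with h | h
  · refine ⟨∅, ⟨countable_empty, fun p hp => hp.elim⟩, Prod.fst ⁻¹' (MulAction.orbit G x), ?_, rfl⟩
    have : IsClosed (MulAction.orbit G x) := ⟨(sigmaB_one h).1 horb⟩
    exact this.preimage continuous_fst
  · obtain ⟨f, hf, e⟩ := (sigmaB_gt h).1 horb
    choose b hb1 hb2 hb3 using hf
    choose F hF hFm using fun n => exists_herFam (α := α) (b n) _ (hb3 n) (hb2 n) (hb1 n)
    refine ⟨⋃ n, F n, HerFam.iUnion hF, ⋂ n, ⋂ U : WW,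
      {z | z.2 ⟨((b n, (f n)ᶜ), U.1), ⟨mem_iUnion.2 ⟨n, hFm n⟩, U.2⟩⟩ = true}, ?_, ?_⟩
    · refine isClosed_iInter fun n => isClosed_iInter fun U => ?_
      have hcc : Continuous fun z : X × (((⋃ n, F n) ×ˢ WW : Set _) → Bool) =>
          z.2 ⟨((b n, (f n)ᶜ), U.1), ⟨mem_iUnion.2 ⟨n, hFm n⟩, U.2⟩⟩ := by fun_prop
      exact (isClosed_discrete {true}).preimage hcc
    · have e2 : MulAction.orbit G x = ⋂ n, (f n)ᶜ := by
        rw [← compl_iUnion, ← e, compl_compl]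
      ext y
      simp only [mem_preimage, mem_iInter, mem_setOf_eq, phi_snd]
      constructor
      · intro hy n U
        have hU : {g : G | g ∈ U.1 ∧ g • y ∈ (f n)ᶜ} = U.1 := by
          ext g
          simp only [mem_setOf_eq, and_iff_left_iff_imp]
          intro _
          have : g • y ∈ MulAction.orbit G x := by
            obtain ⟨k, rfl⟩ := hy
            exact ⟨g * k, mul_smul g k x⟩
          rw [e2] at this
          exact mem_iInter.1 this n
        show ¬ IsMeagre {g : G | g ∈ U.1 ∧ g • y ∈ (f n)ᶜ}
        rw [hU]
        exact not_isMeagre_of_open (hWW.opn _ U.2) (hWW.ne _ U.2)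
      · intro hy
        have hm : ∀ n, IsMeagre {g : G | g ∈ univ ∧ g ∉ {g : G | g • y ∈ (f n)ᶜ}} := by
          intro n
          by_contra hcon
          obtain ⟨U, hU, -, hUm⟩ := (vaught_key hWW (orbit_baire (hb3 n) y) isOpen_univ).1 hcon
          exact hy n ⟨U, hU⟩ hUm
        have : ∃ g : G, ∀ n, g • y ∈ (f n)ᶜ := by
          by_contra! hcon
          refine not_isMeagre_of_open (isOpen_univ (X := G)) ⟨1, trivial⟩
            ((isMeagre_iUnion hm).mono ?_)
          intro g _
          obtain ⟨n, hn⟩ := hcon g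
          exact mem_iUnion.2 ⟨n, trivial, hn⟩
        obtain ⟨g, hg⟩ := this
        have hgy : g • y ∈ MulAction.orbit G x := by
          rw [e2]
          exact mem_iInter.2 hg
        obtain ⟨k, hk⟩ := hgy
        have hk' : k • x = g • y := hk
        exact ⟨g⁻¹ * k, by simp [mul_smul, hk']⟩

theorem open_subgroup_orbit_measurable [MeasurableSpace X] [BorelSpace X] (H : Subgroup G)
    (hH : IsOpen (H : Set G)) (x : X) (hx : MeasurableSet (MulAction.orbit G x))
    {Q : Set G} (hQ : Q.Countable) (hQH : ∀ g : G, ∃ q ∈ Q, g * q⁻¹ ∈ H) :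
    MeasurableSet ((fun g : G => g • x) '' (H : Set G)) := by
  have han : ∀ y : X, MeasureTheory.AnalyticSet ((fun g : G => g • y) '' (H : Set G)) := fun y =>
    hH.analyticSet_image (continuous_id.smul continuous_const)
  refine (han x).measurableSet_of_compl ?_
  haveI := hQ.to_subtype
  have : ((fun g : G => g • x) '' (H : Set G))ᶜ = (MulAction.orbit G x)ᶜ ∪
      ⋃ q : {q : Q // q.1 • x ∉ ((fun g : G => g • x) '' (H : Set G))},
        (fun g : G => g • (q.1.1 • x)) '' (H : Set G) := by
    ext y
    simp only [mem_union, mem_iUnion]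
    constructor
    · intro hy
      by_cases hyo : y ∈ MulAction.orbit G x
      · right
        obtain ⟨g, rfl⟩ := hyo
        obtain ⟨q, hq, hqg⟩ := hQH g
        refine ⟨⟨⟨q, hq⟩, ?_⟩, g * q⁻¹, hqg, by simp [smul_smul]⟩
        rintro ⟨h, hh, e⟩
        apply hy
        refine ⟨g * q⁻¹ * h, H.mul_mem hqg hh, ?_⟩
        have e' : h • x = q • x := e
        simp [mul_smul, e']
      · exact Or.inl hyo
    · rintro (hy | ⟨⟨q, hq⟩, h, hh, rfl⟩)
      · rintro ⟨h, hh, rfl⟩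
        exact hy ⟨h, rfl⟩
      · rintro ⟨k, hk, e⟩
        apply hq
        refine ⟨h⁻¹ * k, H.mul_mem (H.inv_mem hh) hk, ?_⟩
        have e' : k • x = h • (q.1 • x) := e
        simp [mul_smul, e']
  rw [this, union_eq_iUnion]
  refine MeasureTheory.AnalyticSet.iUnion ?_
  rintro (_ | _)
  · exact MeasureTheory.AnalyticSet.iUnion fun q => han _
  · exact hx.compl.analyticSet

theorem open_subgroup_orbit {WW : Set (Set G)} (hWW : GoodB WW) (x : X) (α : Ordinal.{0})
    (horb : MulAction.orbit G x ∈ PiB X α) (H : Subgroup G) (hH : IsOpen (H : Set G)) :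
    (fun g : G => g • x) '' (H : Set G) ∈ PiB X α := by
  obtain ⟨F, hF, C, hC, hCe⟩ := exists_family hWW x α horb
  haveI : Countable (F ×ˢ WW : Set _) := (hF.1.prod hWW.ctb).to_subtype
  obtain ⟨Q, hQ, hQd⟩ := TopologicalSpace.exists_countable_dense G
  have hQ1 : ∀ g : G, ∃ q ∈ Q, g * q⁻¹ ∈ H := by
    intro g
    have ho : IsOpen ((fun k : G => g * k⁻¹) ⁻¹' (H : Set G)) :=
      hH.preimage (by fun_prop)
    obtain ⟨q, h1, h2⟩ := hQd.inter_open_nonempty _ ho ⟨g, by simp⟩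
    exact ⟨q, h2, h1⟩
  have hQ2 : ∀ g : G, ∃ q ∈ Q, q⁻¹ * g ∈ H := by
    intro g
    have ho : IsOpen ((fun k : G => k⁻¹ * g) ⁻¹' (H : Set G)) :=
      hH.preimage (by fun_prop)
    obtain ⟨q, h1, h2⟩ := hQd.inter_open_nonempty _ ho ⟨g, by simp⟩
    exact ⟨q, h2, h1⟩
  let ψ : MulAction.orbit G x → X × ((F ×ˢ WW : Set _) → Bool) := fun y => phi F WW y.1
  have hψi : Function.Injective ψ := fun a b h => Subtype.ext (congrArg Prod.fst h)
  let t : TopologicalSpace (MulAction.orbit G x) := TopologicalSpace.induced ψ inferInstance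
  have hψc : @Continuous _ _ t _ ψ := continuous_induced_dom
  have hrange : range ψ = range (phi F WW) ∩ C := by
    ext z
    constructor
    · rintro ⟨y, rfl⟩
      refine ⟨⟨y.1, rfl⟩, ?_⟩
      exact hCe.subset y.2
    · rintro ⟨⟨y, rfl⟩, hy⟩
      exact ⟨⟨y, by rw [hCe]; exact hy⟩, rfl⟩
  have hG : IsGδ (range ψ) := by
    rw [hrange]
    letI := TopologicalSpace.upgradeIsCompletelyMetrizable (X × ((F ×ˢ WW : Set _) → Bool))
    exact (phi_range_gdelta hWW hF).inter hC.isGδ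
  have hp1 : PolishSpace ((F ×ˢ WW : Set _) → Bool) := by
    have := TopologicalSpace.SecondCountableTopology.to_separableSpace
      (α := (F ×ˢ WW : Set _) → Bool)
    infer_instance
  have hp2 : PolishSpace (X × ((F ×ˢ WW : Set _) → Bool)) := inferInstance
  have hBr := gdelta_baire hG
  have hemb : @Topology.IsEmbedding _ _ t _ ψ := @Topology.IsEmbedding.mk _ _ t _ _
    (@Topology.IsInducing.mk _ _ t _ _ rfl) hψi
  have hBaire : @BaireSpace (MulAction.orbit G x) t :=
    @Homeomorph.baireSpace _ _ _ t hBr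
      (@Homeomorph.symm _ _ t _ (@Topology.IsEmbedding.toHomeomorph _ _ t _ _ hemb))
  have hcont : ∀ g : G, @Continuous _ _ t t fun y : MulAction.orbit G x => g • y := by
    intro g
    refine continuous_induced_rng.2 ?_
    have hval : @Continuous _ _ t _ (fun y : MulAction.orbit G x => y.1) :=
      @Continuous.comp _ _ _ t _ _ ψ Prod.fst continuous_fst hψc
    refine @phi_cont G _ _ _ _ X _ _ _ _ _ t F WW (fun y => g • y.1)
      (@Continuous.comp _ _ _ t _ _ _ _ (continuous_const_smul g) hval) ?_
    intro j
    have hj' : (j.1.1, (fun h : G => h * g⁻¹) ⁻¹' j.1.2) ∈ F ×ˢ WW :=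
      ⟨j.2.1, hWW.tr _ j.2.2 g⟩
    have hcoord : @Continuous _ _ t _ (fun y : MulAction.orbit G x => (ψ y).2 ⟨_, hj'⟩) :=
      @Continuous.comp _ _ _ t _ _ _ _
        (by fun_prop : Continuous fun z : X × ((F ×ˢ WW : Set _) → Bool) => z.2 ⟨_, hj'⟩) hψc
    have h1 : (fun y : MulAction.orbit G x => g • y.1) ⁻¹' DD j.1.1.2 j.1.2 =
        (fun y : MulAction.orbit G x => (ψ y).2 ⟨_, hj'⟩) ⁻¹' {true} := by
      ext y
      simp only [mem_preimage, mem_singleton_iff, DD_smul]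
      exact (phi_snd F WW y.1 ⟨_, hj'⟩).symm
    have hcl := @IsClopen.preimage _ _ t _ _ (isClopen_discrete {true}) _ hcoord
    rw [preimage_compl, h1]
    exact ⟨hcl.2, (@isOpen_compl_iff _ _ t).2 hcl.1⟩
  have htr : ∀ y z : MulAction.orbit G x, ∃ g : G, g • y = z := fun y z =>
    MulAction.exists_smul_eq G y z
  have himg : ∀ y : MulAction.orbit G x, (fun g : G => g • y) '' (H : Set G) =
      (fun y : MulAction.orbit G x => y.1) ⁻¹' ((fun g : G => g • y.1) '' (H : Set G)) := by
    intro y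
    ext z
    constructor
    · rintro ⟨h, hh, rfl⟩
      exact ⟨h, hh, rfl⟩
    · rintro ⟨h, hh, e⟩
      exact ⟨h, hh, Subtype.ext e⟩
  have hBM : ∀ y : MulAction.orbit G x,
      @BaireMeasurableSet _ t ((fun g : G => g • y) '' (H : Set G)) := by
    intro y
    borelize X
    have hxm : MeasurableSet (MulAction.orbit G y.1) := by
      rw [MulAction.orbit_eq_iff.2 y.2]
      exact (sigmaB_measurable α _ horb).of_compl
    have hm := open_subgroup_orbit_measurable H hH y.1 hxm hQ hQ1
    have hval : @Continuous _ _ t _ (fun y : MulAction.orbit G x => y.1) :=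
      @Continuous.comp _ _ _ t _ _ ψ Prod.fst continuous_fst hψc
    rw [himg]
    have hmeas : @Measurable _ _ (@borel _ t) _ (fun y : MulAction.orbit G x => y.1) :=
      @Continuous.measurable _ _ t (@borel _ t)
        (@BorelSpace.opensMeasurable _ t (@borel _ t) (@BorelSpace.mk _ t (@borel _ t) rfl))
        _ _ _ _ hval
    exact @MeasurableSet.baireMeasurableSet _ t _ (@borel _ t) (@BorelSpace.mk _ t (@borel _ t) rfl)
      (hmeas hm)
  have hopen := @effros_open G _ _ t hBaire _ hcont htr H Q hQ hQ2 hBM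
    ⟨x, MulAction.mem_orbit_self x⟩
  obtain ⟨O, hO, hOe⟩ := isOpen_induced_iff.1 hopen
  have hfin : ((fun g : G => g • x) '' (H : Set G))ᶜ =
      (MulAction.orbit G x)ᶜ ∪ phi F WW ⁻¹' O := by
    have hmem : ∀ y (hy : y ∈ MulAction.orbit G x), phi F WW y ∈ O ↔
        y ∉ (fun g : G => g • x) '' (H : Set G) := by
      intro y hy
      have h1 := Set.ext_iff.1 hOe ⟨y, hy⟩
      rw [himg] at h1
      exact h1
    ext y
    simp only [mem_union, mem_preimage]
    by_cases hy : y ∈ MulAction.orbit G x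
    · simp only [mem_compl_iff, hy, not_true, false_or, hmem y hy]
    · refine iff_of_true ?_ (Or.inl hy)
      rintro ⟨h, hh, rfl⟩
      exact hy ⟨h, rfl⟩
  show ((fun g : G => g • x) '' (H : Set G))ᶜ ∈ SigmaB X α
  rw [hfin]
  exact sigmaB_union horb (phi_open_sigma hWW hF hO)

end Main

/-! ### The group `S_∞` -/

theorem sinf_continuous_eval (k : ℕ) : Continuous fun g : Sinf => g k :=
  (continuous_apply k).comp continuous_induced_dom

theorem sinf_continuous_rng {Y : Type*} [TopologicalSpace Y] {f : Y → Sinf}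
    (h : ∀ k, Continuous fun y => f y k) : Continuous f :=
  continuous_induced_rng.2 (continuous_pi h)

theorem sinf_continuous_inv_eval (k : ℕ) : Continuous fun g : Sinf => g⁻¹ k := by
  rw [continuous_discrete_rng]
  intro m
  have : (fun g : Sinf => g⁻¹ k) ⁻¹' {m} = (fun g : Sinf => g m) ⁻¹' {k} := by
    ext g
    simp only [mem_preimage, mem_singleton_iff, Equiv.Perm.inv_eq_iff_eq]
    exact eq_comm
  rw [this]
  exact (isOpen_discrete {k}).preimage (sinf_continuous_eval m)

theorem sinf_continuous_comp_eval {Y : Type*} [TopologicalSpace Y] {f : Y → Sinf} {u : Y → ℕ}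
    (hf : Continuous f) (hu : Continuous u) : Continuous fun y => f y (u y) := by
  rw [continuous_iff_continuousAt]
  intro y
  have h1 : ∀ᶠ z in nhds y, u z = u y := hu.continuousAt.eventually (by rw [nhds_discrete]; rfl : ∀ᶠ m in nhds _, m = _)
  have h2 : ContinuousAt (fun z => f z (u y)) y :=
    ((sinf_continuous_eval (u y)).comp hf).continuousAt
  refine h2.congr ?_
  filter_upwards [h1] with z hz
  rw [hz]

instance sinf_topGroup : IsTopologicalGroup Sinf where
  continuous_mul := by
    refine sinf_continuous_rng fun k => ?_
    exact sinf_continuous_comp_eval (u := fun p : Sinf × Sinf => p.2 k) continuous_fst ((sinf_continuous_eval k).comp continuous_snd)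
  continuous_inv := sinf_continuous_rng fun k => sinf_continuous_inv_eval k

instance sinf_polish : PolishSpace Sinf := by
  let f : Sinf → (ℕ → ℕ) × (ℕ → ℕ) := fun g => (g, (g⁻¹ : Sinf))
  have hfc : Continuous f := by
    refine Continuous.prodMk (continuous_pi sinf_continuous_eval)
      (continuous_pi sinf_continuous_inv_eval)
  have hfi : Topology.IsInducing f := by
    refine ⟨le_antisymm (continuous_iff_le_induced.1 hfc) ?_⟩
    have h1 : (SinfTopology : TopologicalSpace Sinf) =
      TopologicalSpace.induced f (TopologicalSpace.induced Prod.fst Pi.topologicalSpace) := by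
      rw [induced_compose]; rfl
    rw [h1]
    exact induced_mono (continuous_iff_le_induced.1 continuous_fst)
  have hinj : Function.Injective f := fun a b h => by
    have := congrArg Prod.fst h
    exact DFunLike.coe_injective this
  have hr : range f = {p | ∀ k, p.1 (p.2 k) = k ∧ p.2 (p.1 k) = k} := by
    ext p
    constructor
    · rintro ⟨g, rfl⟩ k
      simp [f]
    · intro h
      exact ⟨⟨p.1, p.2, fun k => (h k).2, fun k => (h k).1⟩, rfl⟩
  have hcomp : ∀ (u : ((ℕ → ℕ) × (ℕ → ℕ)) → (ℕ → ℕ)) (v : ((ℕ → ℕ) × (ℕ → ℕ)) → ℕ),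
      Continuous u → Continuous v → Continuous fun p => u p (v p) := by
    intro u v hu hv
    rw [continuous_iff_continuousAt]
    intro y
    have h1 : ∀ᶠ z in nhds y, v z = v y := hv.continuousAt.eventually (by rw [nhds_discrete]; rfl : ∀ᶠ m in nhds _, m = _)
    have h2 : ContinuousAt (fun z => u z (v y)) y :=
      ((continuous_apply (v y)).comp hu).continuousAt
    refine h2.congr ?_
    filter_upwards [h1] with z hz
    rw [hz]
  have hcl : IsClosed (range f) := by
    rw [hr]
    simp only [setOf_forall, setOf_and]
    refine isClosed_iInter fun k => IsClosed.inter ?_ ?_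
    · exact isClosed_eq (hcomp _ _ continuous_fst ((continuous_apply k).comp continuous_snd))
        continuous_const
    · exact isClosed_eq (hcomp _ _ continuous_snd ((continuous_apply k).comp continuous_fst))
        continuous_const
  exact Topology.IsClosedEmbedding.polishSpace (f := f) ⟨⟨hfi, hinj⟩, hcl⟩

theorem vc_mul (G : Subgroup Sinf) (c : Set ℕ) {g h : G} (hg : g ∈ Vc G c) (hh : h ∈ Vc G c) :
    g * h ∈ Vc G c := by
  intro k hk
  show (g : Sinf) ((h : Sinf) k) = k
  rw [hh k hk, hg k hk]

theorem vc_inv (G : Subgroup Sinf) (c : Set ℕ) {g : G} (hg : g ∈ Vc G c) :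
    g⁻¹ ∈ Vc G c := by
  intro k hk
  show (g : Sinf)⁻¹ k = k
  rw [Equiv.Perm.inv_eq_iff_eq, hg k hk]

/-- `V^G_c` as a subgroup. -/
def VcSub (G : Subgroup Sinf) (c : Set ℕ) : Subgroup G where
  carrier := Vc G c
  mul_mem' := fun hg hh => vc_mul G c hg hh
  one_mem' := fun _ _ => rfl
  inv_mem' := fun hg => vc_inv G c hg

theorem vc_open (G : Subgroup Sinf) (c : Finset ℕ) : IsOpen (Vc G (c : Set ℕ)) := by
  have : Vc G (c : Set ℕ) = ⋂ k ∈ c, (fun g : G => (g : Sinf) k) ⁻¹' {k} := by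
    ext g
    simp [Vc]
  rw [this]
  refine isOpen_biInter_finset fun k _ => ?_
  exact (isOpen_discrete {k}).preimage ((sinf_continuous_eval k).comp continuous_subtype_val)

theorem vc_nhds (G : Subgroup Sinf) {O : Set G} (hO : IsOpen O) (h1 : (1 : G) ∈ O) :
    ∃ c : Finset ℕ, Vc G (c : Set ℕ) ⊆ O := by
  obtain ⟨O1, hO1, rfl⟩ := isOpen_induced_iff.1 hO
  obtain ⟨O2, hO2, rfl⟩ := isOpen_induced_iff.1 hO1
  obtain ⟨c, u, hu, hs⟩ := isOpen_pi_iff.1 hO2 _ h1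
  refine ⟨c, fun g hg => hs ?_⟩
  intro k hk
  have := (hu k hk).2
  have e : (g : Sinf) k = k := hg k hk
  show (g : Sinf) k ∈ u k
  rw [e]
  exact this

theorem exists_goodB (G : Subgroup Sinf) [PolishSpace G] : ∃ WW : Set (Set G), GoodB WW := by
  obtain ⟨Q, hQ, hQd⟩ := TopologicalSpace.exists_countable_dense G
  have hop : ∀ (c : Finset ℕ) (g : G),
      IsOpen ((fun h : G => h * g⁻¹) ⁻¹' Vc G (c : Set ℕ)) := fun c g =>
    (vc_open G c).preimage (by fun_prop)
  have h1 : ∀ c : Set ℕ, (1 : G) ∈ Vc G c := fun c => (VcSub G c).one_mem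
  refine ⟨range fun p : Finset ℕ × G => (fun h : G => h * p.2⁻¹) ⁻¹' Vc G (p.1 : Set ℕ),
    ?_, ?_, ?_, ?_, ?_⟩
  · haveI := hQ.to_subtype
    refine (countable_range fun p : Finset ℕ × Q =>
      (fun h : G => h * p.2.1⁻¹) ⁻¹' Vc G (p.1 : Set ℕ)).mono ?_
    rintro _ ⟨⟨c, g⟩, rfl⟩
    obtain ⟨q, hq1, hq2⟩ := hQd.inter_open_nonempty _ (hop c g) ⟨g, by simpa using h1 c⟩
    have hq1 : q * g⁻¹ ∈ Vc G (c : Set ℕ) := hq1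
    refine ⟨⟨c, ⟨q, hq2⟩⟩, ?_⟩
    ext h
    show h * q⁻¹ ∈ Vc G (c : Set ℕ) ↔ h * g⁻¹ ∈ Vc G (c : Set ℕ)
    constructor
    · intro hh
      simpa using vc_mul G _ hh hq1
    · intro hh
      simpa using vc_mul G _ hh (vc_inv G _ hq1)
  · rintro _ ⟨⟨c, g⟩, rfl⟩
    exact hop c g
  · rintro _ ⟨⟨c, g⟩, rfl⟩
    exact ⟨g, by simpa using h1 c⟩
  · intro O hO g hg
    have hO' : IsOpen ((fun h : G => h * g) ⁻¹' O) := hO.preimage (by fun_prop)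
    obtain ⟨c, hc⟩ := vc_nhds G hO' (by simpa using hg)
    refine ⟨_, ⟨⟨c, g⟩, rfl⟩, by simpa using h1 c, ?_⟩
    intro h hh
    simpa using hc hh
  · rintro _ ⟨⟨c, g⟩, rfl⟩ k
    refine ⟨⟨c, g * k⟩, ?_⟩
    ext h
    simp [mul_assoc]

/-- Borel rank of suborbits. -/
theorem suborbit_borel_rank
    (G : Subgroup Sinf) (hGclosed : IsClosed (G : Set Sinf))
    {X : Type*} [TopologicalSpace X] [PolishSpace X] [MulAction G X] [ContinuousSMul G X]
    (x : X) (α : Ordinal.{0}) (hα : 1 ≤ α) (hαc : α.card ≤ Cardinal.aleph0)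
    (horb : MulAction.orbit G x ∈ PiB X α) :
    (∀ c : Finset ℕ, setOrb G (Vc G (↑c : Set ℕ)) x ∈ PiB X α) ∧
    (∀ H : Subgroup G, IsOpen (H : Set G) → setOrb G (H : Set G) x ∈ PiB X (α + 2)) := by
  haveI : PolishSpace G := hGclosed.polishSpace
  obtain ⟨WW, hWW⟩ := exists_goodB G
  have key : ∀ H : Subgroup G, IsOpen (H : Set G) → setOrb G (H : Set G) x ∈ PiB X α :=
    fun H hH => open_subgroup_orbit hWW x α horb H hH
  refine ⟨fun c => key (VcSub G (c : Set ℕ)) (vc_open G c), fun H hH => ?_⟩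
  exact sigmaB_mono le_self_add (key H hH)
end
end
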